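/- arXiv:1206.2962 — 6 statements merged into one kernel-verified Lean document; each statement's English description precedes it below -/
import Mathlib

section
/- Let n ≥ 1 and r ≥ 1 be natural numbers. If the special linear group SL(2, F) over the field F with 2^n elements is isomorphic to a section of the general linear group GL(r, ℤ/2ℤ) (i.e., isomorphic to a quotient H/N where N is a normal subgroup of a subgroup H of GL(r, ℤ/2ℤ)), then 2n ≤ r. -/
open Polynomial in
/-- For `2 ≤ m` there is a prime power modulo which `2` has multiplicative order exactly `m`. -/
theorem exists_prime_pow_orderOf_two_eq {m : ℕ} (hm : 2 ≤ m) :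
    ∃ p k : ℕ, p.Prime ∧ p ^ (k + 1) ∣ 2 ^ m - 1 ∧ orderOf (2 : ZMod (p ^ (k + 1))) = m := by
  obtain ⟨p, hp, hpc⟩ := Nat.exists_prime_and_dvd
    (sub_one_lt_natAbs_cyclotomic_eval (n := m) (q := 2) hm (by norm_num)).ne'
  have hpc' : (p : ℤ) ∣ (cyclotomic m ℤ).eval 2 := by
    simpa using Int.natCast_dvd.mpr hpc
  have hpos : 2 ^ m - 1 ≠ 0 := by
    have := Nat.one_lt_two_pow (n := m) (by lia)
    lia
  have hdvd : p ∣ 2 ^ m - 1 := by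
    zify [Nat.one_le_two_pow (n := m)]
    simpa using hpc'.trans (eval_dvd (cyclotomic.dvd_X_pow_sub_one m ℤ) (x := 2))
  obtain ⟨k, hk⟩ : ∃ k, (2 ^ m - 1).factorization p = k + 1 :=
    Nat.exists_eq_succ_of_ne_zero (hp.factorization_pos_of_dvd hpos hdvd).ne'
  have two_pow (d : ℕ) : (2 : ZMod (p ^ (k + 1))) ^ d = 1 ↔ p ^ (k + 1) ∣ 2 ^ d - 1 := by
    rw [← ZMod.natCast_eq_zero_iff, Nat.cast_sub Nat.one_le_two_pow, sub_eq_zero]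
    simp
  have hpk : p ^ (k + 1) ∣ 2 ^ m - 1 := hk ▸ Nat.ordProj_dvd _ _
  refine ⟨p, k, hp, hpk, ?_⟩
  have hord := orderOf_dvd_of_pow_eq_one ((two_pow m).2 hpk)
  by_contra hne
  set d := orderOf (2 : ZMod (p ^ (k + 1)))
  have hd := (two_pow d).1 (pow_orderOf_eq_one _)
  have key : p ^ (k + 1 + 1) ∣ 2 ^ m - 1 := by
    have h1 := eval_dvd (X_pow_sub_one_mul_cyclotomic_dvd_X_pow_sub_one_of_dvd ℤ
      (Nat.mem_properDivisors.2 ⟨hord, (Nat.le_of_dvd (by lia) hord).lt_of_ne hne⟩)) (x := 2)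
    zify [Nat.one_le_two_pow (n := d)] at hd
    zify [Nat.one_le_two_pow (n := m)]
    rw [pow_succ]
    exact (mul_dvd_mul hd hpc').trans (by simpa using h1)
  exact Nat.pow_succ_factorization_not_dvd hpos hp (by rwa [hk])

/-- The special linear group of degree two over a finite field `F` contains a nonsplit torus,
which is cyclic of order `|F| + 1`. -/
theorem Matrix.SpecialLinearGroup.exists_orderOf_eq_natCard_add_one
    (F : Type*) [Field F] [Finite F] :
    ∃ g : Matrix.SpecialLinearGroup (Fin 2) F, orderOf g = Nat.card F + 1 := by
  obtain ⟨p, _⟩ := CharP.exists F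
  have : Fact p.Prime := ⟨CharP.char_is_prime F p⟩
  let K := FiniteField.Extension F p 2
  have hrank : Module.finrank F K = 2 := FiniteField.finrank_extension F p 2
  have hcard : Nat.card K = Nat.card F ^ 2 := FiniteField.natCard_extension F p 2
  have hF : 1 < Nat.card F := Finite.one_lt_card
  obtain ⟨g, hg⟩ := IsCyclic.exists_ofOrder_eq_natCard (α := Kˣ)
  have hsq : Nat.card F ^ 2 - 1 = (Nat.card F - 1) * (Nat.card F + 1) := by
    rw [mul_comm, ← Nat.sq_sub_sq, one_pow]
  rw [Nat.card_units, hcard, hsq] at hg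
  have hx : orderOf (g ^ (Nat.card F - 1)) = Nat.card F + 1 := by
    rw [orderOf_pow_of_dvd (by lia) (hg ▸ dvd_mul_right _ _), hg,
      Nat.mul_div_cancel_left _ (by lia)]
  set x := g ^ (Nat.card F - 1)
  let b := Module.finBasisOfFinrankEq F K hrank
  have hnorm : Algebra.norm F (x : K) = 1 := by
    apply (algebraMap F K).injective
    rw [FiniteField.algebraMap_norm_eq_pow, hcard, hsq, Nat.mul_div_cancel_left _ (by lia), ← hx,
      map_one]
    rw [← Units.val_pow_eq_pow_val, pow_orderOf_eq_one, Units.val_one]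
  refine ⟨⟨Algebra.leftMulMatrix b x, by rw [← Algebra.norm_eq_matrix_det, hnorm]⟩, ?_⟩
  rw [← hx, ← orderOf_units (y := x),
    ← orderOf_injective (Algebra.leftMulMatrix b).toMonoidHom (Algebra.leftMulMatrix_injective b) x]
  exact (orderOf_injective (Matrix.SpecialLinearGroup.coeMonoidHom (ι := Fin 2) (R := F))
    Matrix.SpecialLinearGroup.coeMonoidHom_injective _).symm

open Polynomial in
/-- A matrix of prime power order `p ^ (k + 1)` over a field with `q` elements, `p ∤ q`, has size
at least the multiplicative order of `q` modulo `p ^ (k + 1)`. -/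
theorem Matrix.orderOf_natCast_le_card {ι K : Type*} [Fintype ι] [DecidableEq ι] [Field K]
    [Fintype K] {p k : ℕ} (hp : p.Prime) (hpK : (Fintype.card K).Coprime p) {A : Matrix ι ι K}
    (hA : orderOf A = p ^ (k + 1)) :
    orderOf (Fintype.card K : ZMod (p ^ (k + 1))) ≤ Fintype.card ι := by
  have : Fact p.Prime := ⟨hp⟩
  have hcop : ¬ IsCoprime (minpoly K A) (cyclotomic (p ^ (k + 1)) K) := by
    intro hc
    have h1 : minpoly K A ∣ X ^ p ^ k - 1 := by
      refine hc.dvd_of_dvd_mul_left ?_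
      rw [cyclotomic_prime_pow_mul_X_pow_sub_one]
      apply minpoly.dvd
      simp [← hA, pow_orderOf_eq_one]
    have h2 := aeval_eq_zero_of_dvd_aeval_eq_zero h1 (minpoly.aeval K A)
    have h3 : A ^ p ^ k = 1 := by simpa [sub_eq_zero] using h2
    have h4 := orderOf_dvd_of_pow_eq_one h3
    rw [hA, Nat.pow_dvd_pow_iff_le_right hp.one_lt] at h4
    lia
  obtain ⟨P, hPirr, hPA, hPc⟩ :
      ∃ P, Irreducible P ∧ P ∣ minpoly K A ∧ P ∣ cyclotomic (p ^ (k + 1)) K := by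
    by_contra! h
    exact hcop (isCoprime_of_irreducible_dvd (by simp [cyclotomic_ne_zero]) h)
  obtain ⟨l, _, f, hl, hlf⟩ := FiniteField.card' K
  have : Fact l.Prime := ⟨hl⟩
  have hlp : l.Coprime (p ^ (k + 1)) :=
    ((Nat.coprime_pow_left_iff f.pos l p).1 (hlf ▸ hpK)).pow_right _
  have hdeg := natDegree_of_dvd_cyclotomic_of_irreducible hlf hlp hPc hPirr
  calc orderOf (Fintype.card K : ZMod (p ^ (k + 1))) = P.natDegree := by
        rw [hdeg, ← orderOf_units, ZMod.coe_unitOfCoprime, hlf]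
    _ ≤ A.charpoly.natDegree :=
        natDegree_le_of_dvd (hPA.trans (Matrix.minpoly_dvd_charpoly A)) A.charpoly_monic.ne_zero
    _ = Fintype.card ι := A.charpoly_natDegree_eq_dim

/-- If `SL(2, 𝔽_{2^n})` is isomorphic to a section `H ⧸ N` of `GL(r, ℤ/2ℤ)`,
then `2 * n ≤ r`. -/
theorem sl2_section_of_gl_r_two (n r : ℕ) (hn : 1 ≤ n) (hr : 1 ≤ r)
    (H : Subgroup (Matrix.GeneralLinearGroup (Fin r) (ZMod 2)))
    (N : Subgroup H) [N.Normal]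
    (h : Nonempty ((H ⧸ N) ≃* Matrix.SpecialLinearGroup (Fin 2) (GaloisField 2 n))) :
    2 * n ≤ r := by
  obtain ⟨e⟩ := h
  obtain ⟨p, k, hp, hdvd, hord⟩ := exists_prime_pow_orderOf_two_eq (m := 2 * n) (by lia)
  have hpow : 1 < 2 ^ n := Nat.one_lt_two_pow (by lia)
  have hpdvd : p ∣ 2 ^ (2 * n) - 1 := (dvd_pow_self p k.succ_ne_zero).trans hdvd
  have hodd : p.Coprime 2 := by
    refine (Nat.coprime_primes hp Nat.prime_two).2 ?_
    rintro rfl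
    have h2 : 2 ∣ 2 ^ (2 * n) := dvd_pow_self 2 (by lia)
    have := Nat.one_le_two_pow (n := 2 * n)
    lia
  have hfac : 2 ^ (2 * n) - 1 = (2 ^ n + 1) * (2 ^ n - 1) := by
    rw [← Nat.sq_sub_sq, one_pow, ← pow_mul, mul_comm]
  have hq : p ^ (k + 1) ∣ 2 ^ n + 1 := by
    by_cases hpn : p ∣ 2 ^ n - 1
    · have hpn' : ¬ p ∣ 2 ^ n + 1 := fun h' ↦ by
        have : p ∣ 2 := by
          convert! Nat.dvd_sub h' hpn using 1
          lia
        exact hp.one_lt.ne' (Nat.eq_one_of_dvd_coprimes hodd dvd_rfl this)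
      have h1 : p ^ (k + 1) ∣ 2 ^ n - 1 :=
        (((Nat.Prime.coprime_iff_not_dvd hp).2 hpn').pow_left _).dvd_of_dvd_mul_left (hfac ▸ hdvd)
      have h2 : (2 : ZMod (p ^ (k + 1))) ^ n = 1 := by
        rw [← ZMod.natCast_eq_zero_iff, Nat.cast_sub Nat.one_le_two_pow, sub_eq_zero] at h1
        simpa using h1
      have h3 := Nat.le_of_dvd hn (orderOf_dvd_of_pow_eq_one h2)
      lia
    · exact (((Nat.Prime.coprime_iff_not_dvd hp).2 hpn).pow_left _).dvd_of_dvd_mul_right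
        (hfac ▸ hdvd)
  obtain ⟨g, hg⟩ :=
    Matrix.SpecialLinearGroup.exists_orderOf_eq_natCard_add_one (GaloisField 2 n)
  rw [GaloisField.card 2 n (by lia)] at hg
  obtain ⟨y, rfl⟩ := (e.surjective.comp (QuotientGroup.mk'_surjective N)) g
  have hy : p ^ (k + 1) ∣ orderOf y := by
    rw [← hg] at hq
    exact hq.trans (orderOf_map_dvd (e.toMonoidHom.comp (QuotientGroup.mk' N)) y)
  have hA : orderOf (((y ^ (orderOf y / p ^ (k + 1)) : H) : Matrix.GeneralLinearGroup (Fin r) (ZMod 2)) :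
      Matrix (Fin r) (Fin r) (ZMod 2)) = p ^ (k + 1) := by
    rw [orderOf_units, Subgroup.orderOf_coe, orderOf_pow_orderOf_div (orderOf_pos y).ne' hy]
  simpa [hord] using Matrix.orderOf_natCast_le_card hp (by simpa using hodd.symm) hA
end

section
/- Let n ≥ 1 and r ≥ 1 be natural numbers. If 2^(2n) − 1 divides the least common multiple of the numbers 2^i − 1 for i = 1, …, r, then 2n ≤ r. -/
open Polynomial in
/-- For a proper divisor `d` of `n`, the integer `a ^ d - 1` times the value of the `n`-th cyclotomic
polynomial at `a` divides `a ^ n - 1`. -/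
theorem Nat.pow_sub_one_mul_natAbs_cyclotomic_eval_dvd {a d n : ℕ} (ha : 0 < a)
    (h : d ∈ n.properDivisors) :
    (a ^ d - 1) * ((cyclotomic n ℤ).eval (a : ℤ)).natAbs ∣ a ^ n - 1 := by
  have hdvd := map_dvd (evalRingHom (a : ℤ))
    (X_pow_sub_one_mul_cyclotomic_dvd_X_pow_sub_one_of_dvd ℤ h)
  simp only [coe_evalRingHom, eval_mul, eval_sub, eval_pow, eval_X, eval_one] at hdvd
  have hcast (k : ℕ) : (a : ℤ) ^ k - 1 = ((a ^ k - 1 : ℕ) : ℤ) := by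
    rw [Nat.cast_sub (Nat.one_le_pow _ _ ha)]
    push_cast
    rfl
  rw [hcast, hcast, ← Int.natAbs_dvd_natAbs, Int.natAbs_mul] at hdvd
  simpa only [Int.natAbs_natCast] using hdvd

/-- A nontrivial prime power dividing the least common multiple of a finite family of nonzero
naturals divides a member of the family. -/
theorem Nat.Prime.exists_pow_dvd_of_pow_dvd_finset_lcm {ι : Type*} {p e : ℕ} (hp : p.Prime)
    (he : e ≠ 0) {s : Finset ι} {f : ι → ℕ} (hf : ∀ i ∈ s, f i ≠ 0) (h : p ^ e ∣ s.lcm f) :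
    ∃ i ∈ s, p ^ e ∣ f i := by
  classical
  induction s using Finset.induction_on with
  | empty =>
    rw [Finset.lcm_empty, Nat.dvd_one, Nat.pow_eq_one] at h
    exact absurd h (by simp [hp.ne_one, he])
  | insert a s _ ih =>
    have ha : f a ≠ 0 := hf a (Finset.mem_insert_self a s)
    have hs : ∀ i ∈ s, f i ≠ 0 := fun i hi => hf i (Finset.mem_insert_of_mem hi)
    have hl : s.lcm f ≠ 0 := by
      simpa [Finset.lcm_eq_zero_iff] using hs
    rw [Finset.lcm_insert, lcm_eq_nat_lcm,
      hp.pow_dvd_iff_le_factorization (Nat.lcm_ne_zero ha hl), Nat.factorization_lcm ha hl,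
      Finsupp.sup_apply, le_sup_iff, ← hp.pow_dvd_iff_le_factorization ha,
      ← hp.pow_dvd_iff_le_factorization hl] at h
    rcases h with h | h
    · exact ⟨a, Finset.mem_insert_self a s, h⟩
    · obtain ⟨i, hi, hdvd⟩ := ih hs h
      exact ⟨i, Finset.mem_insert_of_mem hi, hdvd⟩

open Polynomial in
/-- If `a ^ m - 1` divides `lcm {a ^ i - 1 : i = 1, …, r}`, where `2 ≤ a` and `2 ≤ m`,
then `m ≤ r`. -/
theorem Nat.le_of_pow_sub_one_dvd_lcm {a m r : ℕ} (ha : 2 ≤ a) (hm : 2 ≤ m)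
    (h : a ^ m - 1 ∣ (Finset.Icc 1 r).lcm (fun i => a ^ i - 1)) : m ≤ r := by
  have hne (k : ℕ) (hk : k ≠ 0) : a ^ k - 1 ≠ 0 :=
    Nat.sub_ne_zero_of_lt (Nat.one_lt_pow hk ha)
  have hΦ : ((cyclotomic m ℤ).eval (a : ℤ)).natAbs ≠ 1 := by
    have := sub_one_lt_natAbs_cyclotomic_eval (n := m) (q := a) hm (by omega)
    omega
  obtain ⟨p, hp, hpΦ⟩ := Nat.exists_prime_and_dvd hΦ
  have hm0 : a ^ m - 1 ≠ 0 := hne m (by omega)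
  set e := (a ^ m - 1).factorization p
  have hstep {d : ℕ} {k : ℕ} (hd : d ∈ m.properDivisors) (hk : p ^ k ∣ a ^ d - 1) : k < e := by
    rw [← Nat.succ_le_iff, ← hp.pow_dvd_iff_le_factorization hm0, pow_succ]
    exact (mul_dvd_mul hk hpΦ).trans
      (Nat.pow_sub_one_mul_natAbs_cyclotomic_eval_dvd (by omega) hd)
  have he : 0 < e := hstep (d := 1) (Nat.one_mem_properDivisors_iff_one_lt.2 hm) (by simp)
  have hpe : p ^ e ∣ a ^ m - 1 := Nat.ordProj_dvd _ _
  obtain ⟨i, hi, hdvd⟩ := hp.exists_pow_dvd_of_pow_dvd_finset_lcm he.ne'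
    (fun i hi => hne i (by have := (Finset.mem_Icc.1 hi).1; omega)) (hpe.trans h)
  rw [Finset.mem_Icc] at hi
  by_contra! hlt
  have hgcd : p ^ e ∣ a ^ Nat.gcd m i - 1 := by
    rw [← Nat.pow_sub_one_gcd_pow_sub_one]
    exact Nat.dvd_gcd hpe hdvd
  refine (hstep (Nat.mem_properDivisors.2 ⟨Nat.gcd_dvd_left m i, ?_⟩) hgcd).false
  exact (Nat.gcd_le_right m hi.1).trans_lt (hi.2.trans_lt hlt)

/-- If `2^(2n) - 1` divides `lcm {2^i - 1 : i = 1, …, r}`, then `2n ≤ r`. -/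
theorem two_n_le_r_of_dvd_lcm (n r : ℕ) (hn : 1 ≤ n) (hr : 1 ≤ r)
    (h : 2 ^ (2 * n) - 1 ∣ (Finset.Icc 1 r).lcm (fun i => 2 ^ i - 1)) :
    2 * n ≤ r :=
  Nat.le_of_pow_sub_one_dvd_lcm le_rfl (by omega) h
end

section
/- Let n ≥ 1 and r ≥ 1 be natural numbers. If 2^(4n−2) + 1 divides the least common multiple of the numbers 2^i − 1 for i = 1, …, r, then 8n − 4 ≤ r. -/
open Polynomial in
/-- If a prime `p` divides `Φ_N(a)`, then the order of `a` modulo `p` is the prime-to-`p` part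
of `N`. -/
theorem exists_isPrimitiveRoot_of_dvd_cyclotomic_eval {p N : ℕ} (hp : p.Prime) (hN : N ≠ 0)
    {a : ℤ} (h : (p : ℤ) ∣ (cyclotomic N ℤ).eval a) :
    ∃ k m : ℕ, ¬ p ∣ m ∧ N = p ^ k * m ∧ IsPrimitiveRoot (a : ZMod p) m := by
  have : Fact p.Prime := ⟨hp⟩
  obtain ⟨k, m, hm, rfl⟩ := Nat.exists_eq_pow_mul_and_not_dvd hN p hp.ne_one
  have : NeZero (m : ZMod p) := ⟨by rwa [Ne, ZMod.natCast_eq_zero_iff]⟩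
  refine ⟨k, m, hm, rfl, ?_⟩
  rw [← isRoot_cyclotomic_prime_pow_mul_iff_of_charP (k := k) (p := p), IsRoot.def,
    ← map_cyclotomic_int, eval_intCast_map]
  simpa using (ZMod.intCast_zmod_eq_zero_iff_dvd _ p).2 h

open Polynomial in
theorem not_sq_dvd_cyclotomic_eval {p N : ℕ} (hp : p.Prime) (hodd : p ≠ 2) (hN : N ≠ 0)
    (hpN : p ∣ N) {a : ℤ} (ha : 1 < a) (h : (p : ℤ) ∣ (cyclotomic N ℤ).eval a) :
    ¬ (p : ℤ) ^ 2 ∣ (cyclotomic N ℤ).eval a := by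
  have : Fact p.Prime := ⟨hp⟩
  obtain ⟨k, m, hm, hNkm, hroot⟩ := exists_isPrimitiveRoot_of_dvd_cyclotomic_eval hp hN h
  obtain ⟨d, rfl⟩ := hpN
  have hd : d ≠ 0 := right_ne_zero_of_mul hN
  have hmd : m ∣ d := by
    have : m ∣ p * d := hNkm ▸ Dvd.intro_left _ rfl
    exact (((Nat.Prime.coprime_iff_not_dvd hp).2 hm).symm).dvd_of_dvd_mul_left this
  have hone : (a : ZMod p) ^ d = 1 := (hroot.pow_eq_one_iff_dvd d).2 hmd
  have hdvd : (p : ℤ) ∣ a ^ d - 1 := by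
    rw [← ZMod.intCast_zmod_eq_zero_iff_dvd]
    simp [hone]
  have hnd : ¬ (p : ℤ) ∣ a ^ d := by
    rw [← ZMod.intCast_zmod_eq_zero_iff_dvd]
    simp [hone]
  have hsum := emultiplicity_geom_sum₂_eq_one (Nat.prime_iff_prime_int.1 hp) (hp.odd_of_ne_two hodd) hdvd hnd
  have hpos : a ^ d - 1 ≠ 0 := by
    have := one_lt_pow₀ ha hd
    omega
  have hprod : (cyclotomic (p * d) ℤ).eval a ∣
      ∑ i ∈ Finset.range p, (a ^ d) ^ i * 1 ^ (p - 1 - i) := by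
    have hmem : d ∈ (p * d).properDivisors :=
      Nat.mem_properDivisors.2 ⟨Dvd.intro_left _ rfl,
        lt_mul_of_one_lt_left (Nat.pos_of_ne_zero hd) hp.one_lt⟩
    have := map_dvd (evalRingHom a) (X_pow_sub_one_mul_cyclotomic_dvd_X_pow_sub_one_of_dvd ℤ hmem)
    rw [← mul_dvd_mul_iff_left hpos, mul_comm _ (∑ i ∈ _, _), (Commute.all _ _).geom_sum₂_mul]
    simpa [← pow_mul, mul_comm d p] using this
  intro hsq
  have := le_emultiplicity_of_pow_dvd (hsq.trans hprod)
  rw [hsum] at this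
  norm_num at this

open Polynomial in
/-- A form of Zsigmondy's theorem in base `2`. -/
theorem exists_prime_isPrimitiveRoot_two {N : ℕ} (hN : 1 < N)
    (h : ∀ p : ℕ, p.Prime → p ∣ N → ((cyclotomic N ℤ).eval 2).natAbs ≠ p) :
    ∃ p : ℕ, p.Prime ∧ IsPrimitiveRoot (2 : ZMod p) N := by
  have hN0 : N ≠ 0 := by omega
  set c := ((cyclotomic N ℤ).eval 2).natAbs with hc
  have hc1 : 1 < c := by
    simpa using sub_one_pow_totient_lt_natAbs_cyclotomic_eval (q := 2) hN (by norm_num)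
  have hdvd {p : ℕ} (hpc : p ∣ c) : (p : ℤ) ∣ (cyclotomic N ℤ).eval 2 := Int.natCast_dvd.2 hpc
  have hroot {p : ℕ} (hp : p.Prime) (hpc : p ∣ c) :
      ∃ k m : ℕ, ¬ p ∣ m ∧ N = p ^ k * m ∧ IsPrimitiveRoot (2 : ZMod p) m := by
    simpa using exists_isPrimitiveRoot_of_dvd_cyclotomic_eval hp hN0 (hdvd hpc)
  have hodd {p : ℕ} (hp : p.Prime) (hpc : p ∣ c) : p ≠ 2 := by
    rintro rfl
    obtain ⟨k, m, hm, -, hr⟩ := hroot hp hpc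
    have h0 : m ≠ 0 := by rintro rfl; simp at hm
    have := hr.pow_eq_one
    rw [show (2 : ZMod 2) = 0 from rfl, zero_pow h0] at this
    exact zero_ne_one this
  by_contra! hcon
  have hpN {p : ℕ} (hp : p.Prime) (hpc : p ∣ c) : p ∣ N := by
    obtain ⟨k, m, -, hNkm, hr⟩ := hroot hp hpc
    rcases k.eq_zero_or_pos with rfl | hk
    · exact absurd (by simpa [hNkm] using hr) (hcon p hp)
    · exact hNkm ▸ (dvd_pow_self p hk.ne').mul_right m
  have hle {p q : ℕ} (hp : p.Prime) (hpc : p ∣ c) (hq : q.Prime) (hqc : q ∣ c) : q ≤ p := by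
    have : Fact p.Prime := ⟨hp⟩
    obtain ⟨k, m, -, hNkm, hr⟩ := hroot hp hpc
    rcases hq.dvd_mul.1 (hNkm ▸ hpN hq hqc) with hqp | hqm
    · exact Nat.le_of_dvd hp.pos (hq.dvd_of_dvd_pow hqp)
    · have h2 : (2 : ZMod p) ≠ 0 := by
        intro h0
        have : p ∣ 2 := (ZMod.natCast_eq_zero_iff 2 p).1 (by exact_mod_cast h0)
        exact hodd hp hpc ((Nat.prime_dvd_prime_iff_eq hp Nat.prime_two).1 this)
      have hmp : m ∣ p - 1 := hr.dvd_of_pow_eq_one _ (ZMod.pow_card_sub_one_eq_one h2)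
      have := Nat.le_of_dvd (Nat.sub_pos_of_lt hp.one_lt) (hqm.trans hmp)
      omega
  obtain ⟨p, hp, hpc⟩ := Nat.exists_prime_and_dvd hc1.ne'
  have hpow := Nat.eq_prime_pow_of_unique_prime_dvd (by omega : c ≠ 0)
    fun {d} hd hdc => le_antisymm (hle hp hpc hd hdc) (hle hd hdc hp hpc)
  have hsq := not_sq_dvd_cyclotomic_eval hp (hodd hp hpc) hN0 (hpN hp hpc) one_lt_two (hdvd hpc)
  have hlt : c.primeFactorsList.length < 2 := by
    by_contra! hge
    apply hsq
    rw [← Nat.cast_pow, Int.natCast_dvd, ← hc, hpow]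
    exact pow_dvd_pow p hge
  have hlen : c.primeFactorsList.length = 1 := by
    rcases Nat.lt_succ_iff_lt_or_eq.1 hlt with h0 | h1
    · rw [Nat.lt_one_iff.1 h0, pow_zero] at hpow
      omega
    · exact h1
  rw [hlen, pow_one] at hpow
  exact h p hp (hpN hp hpc) hpow

open Polynomial in
theorem lt_natAbs_cyclotomic_four_mul_eval_two {p k : ℕ} (hk : 0 < k) (hp : p.Prime)
    (hpk : p ∣ 4 * k) : p < ((cyclotomic (4 * k) ℤ).eval 2).natAbs := by
  have heval : (cyclotomic (4 * k) ℤ).eval 2 = (cyclotomic (2 * k) ℤ).eval ((4 : ℕ) : ℤ) := by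
    rw [show 4 * k = 2 * k * 2 by ring,
      ← cyclotomic_expand_eq_cyclotomic Nat.prime_two (Dvd.intro _ rfl), expand_eval]
    norm_num
  have hp2k : p ∣ 2 * k := by
    rw [show 4 * k = 2 * (2 * k) by ring] at hpk
    rcases hp.dvd_mul.1 hpk with h | h
    · exact h.mul_right k
    · exact h
  have htot : p - 1 ≤ (2 * k).totient := by
    rw [← Nat.totient_prime hp]
    exact Nat.le_of_dvd (Nat.totient_pos.2 (by omega)) (Nat.totient_dvd_of_dvd hp2k)
  rw [heval]
  have hlt : p - 1 < 3 ^ (p - 1) := Nat.lt_pow_self (by norm_num)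
  calc p ≤ 3 ^ (p - 1) := by omega
    _ ≤ (4 - 1) ^ (2 * k).totient := Nat.pow_le_pow_right (by norm_num) htot
    _ < _ := sub_one_pow_totient_lt_natAbs_cyclotomic_eval (by omega) (by norm_num)

/-- If `2^(4n-2) + 1` divides `lcm {2^i - 1 : i = 1, …, r}`, then `8n - 4 ≤ r`. -/
theorem suzuki_exponent_bound (n r : ℕ) (hn : 1 ≤ n) (hr : 1 ≤ r)
    (h : 2 ^ (4 * n - 2) + 1 ∣ (Finset.Icc 1 r).lcm (fun i => 2 ^ i - 1)) :
    8 * n - 4 ≤ r := by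
  obtain ⟨p, hp, hroot⟩ := exists_prime_isPrimitiveRoot_two (N := 4 * (2 * n - 1)) (by omega)
    fun p hp hpN => (lt_natAbs_cyclotomic_four_mul_eval_two (by omega) hp hpN).ne'
  have : Fact p.Prime := ⟨hp⟩
  have hpdvd : p ∣ 2 ^ (4 * n - 2) + 1 := by
    have hsq : ((2 : ZMod p) ^ (4 * n - 2)) ^ 2 = 1 := by
      rw [← pow_mul, show (4 * n - 2) * 2 = 4 * (2 * n - 1) by omega, hroot.pow_eq_one]
    have hne : (2 : ZMod p) ^ (4 * n - 2) ≠ 1 :=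
      hroot.pow_ne_one_of_pos_of_lt (by omega) (by omega)
    rw [← ZMod.natCast_eq_zero_iff]
    push_cast
    rw [(sq_eq_one_iff.1 hsq).resolve_left hne, neg_add_cancel]
  obtain ⟨i, hi, hpi⟩ := (hp.prime.dvd_finsetProd_iff _).1
    ((hpdvd.trans h).trans (Finset.lcm_dvd_prod _ _))
  rw [Finset.mem_Icc] at hi
  have hpow : (2 : ZMod p) ^ i = 1 := by
    rw [← ZMod.natCast_eq_zero_iff, Nat.cast_sub Nat.one_le_two_pow] at hpi
    simpa [sub_eq_zero] using hpi
  have := Nat.le_of_dvd (by omega) (hroot.dvd_of_pow_eq_one i hpow)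
  omega
end

section
/- Let n ≥ 2 and r ≥ 1 be natural numbers. If 2^(2n) − 2^n + 1 divides gcd(2^n + 1, 3) · lcm{2^i − 1 : i = 1, …, r}, then 6n ≤ r. -/
open Polynomial in
theorem eval_cyclotomic_mul_prime_pow {R : Type*} [CommRing R] {p n : ℕ} (hp : p.Prime)
    (hn : p ∣ n) (x : R) (k : ℕ) :
    eval x (cyclotomic (n * p ^ k) R) = eval (x ^ p ^ k) (cyclotomic n R) := by
  induction k generalizing x with
  | zero => simp
  | succ k ih =>
    rw [pow_succ, ← mul_assoc, ← cyclotomic_expand_eq_cyclotomic hp (hn.mul_right _), expand_eval,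
      ih, ← pow_mul, mul_comm]

open Polynomial in
theorem prime_lt_eval_cyclotomic_mul {p d : ℕ} (hp : p.Prime) (hpd : ¬p ∣ d) (hd : 2 ≤ d) {x : ℝ}
    (hx : 1 < x) (h : p * (x + 1) ≤ x ^ p - 1) : (p : ℝ) < eval x (cyclotomic (d * p) ℝ) := by
  have hmul : eval (x ^ p) (cyclotomic d ℝ) =
      eval x (cyclotomic (d * p) ℝ) * eval x (cyclotomic d ℝ) := by
    rw [← expand_eval, cyclotomic_expand_eq_cyclotomic_mul hp hpd, eval_mul]
  have hlow := sub_one_pow_totient_lt_cyclotomic_eval hd (one_lt_pow₀ hx hp.ne_zero)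
  have hup := cyclotomic_eval_le_add_one_pow_totient hx d
  have hpos := cyclotomic_pos' d hx
  have hp1 : (1 : ℝ) ≤ p := mod_cast hp.one_le
  have htot : d.totient ≠ 0 := (Nat.totient_pos.2 (by lia)).ne'
  refine lt_of_mul_lt_mul_right ?_ hpos.le
  calc (p : ℝ) * eval x (cyclotomic d ℝ) ≤ p ^ d.totient * (x + 1) ^ d.totient := by
        gcongr
        exact le_self_pow₀ hp1 htot
    _ = (p * (x + 1)) ^ d.totient := (mul_pow _ _ _).symm
    _ ≤ (x ^ p - 1) ^ d.totient := by gcongr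
    _ < _ := hlow.trans_eq hmul

theorem mul_add_one_le_pow_sub_one_of_five_le {p : ℕ} (hp : 5 ≤ p) {x : ℝ} (hx : 2 ≤ x) :
    p * (x + 1) ≤ x ^ p - 1 := by
  induction p, hp using Nat.le_induction with
  | base =>
    have h4 : (2 : ℝ) ^ 4 ≤ x ^ 4 := by gcongr
    norm_num at h4 ⊢
    nlinarith
  | succ p hp ih =>
    have hp' : (5 : ℝ) ≤ p := mod_cast hp
    push_cast
    rw [pow_succ]
    have hmul : x ^ p * 2 ≤ x ^ p * x := by gcongr
    nlinarith

open Polynomial in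
theorem prime_lt_eval_two_cyclotomic {p d k : ℕ} (hp : p.Prime) (hp3 : 3 ≤ p) (hpd : ¬p ∣ d)
    (hd : 2 ≤ d) (h : 5 ≤ p ∨ 1 ≤ k) :
    (p : ℝ) < eval 2 (cyclotomic (d * p * p ^ k) ℝ) := by
  rw [eval_cyclotomic_mul_prime_pow hp (dvd_mul_left p d)]
  have hpk : p ^ k ≠ 0 := pow_ne_zero _ hp.ne_zero
  refine prime_lt_eval_cyclotomic_mul hp hpd hd (one_lt_pow₀ one_lt_two hpk) ?_
  by_cases hp5 : 5 ≤ p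
  · exact mul_add_one_le_pow_sub_one_of_five_le hp5 (le_self_pow₀ one_le_two hpk)
  · have hp4 : p ≠ 4 := by rintro rfl; revert hp; decide
    obtain rfl : p = 3 := by lia
    have hk : 3 ≤ 3 ^ k := le_self_pow₀ (by norm_num) (by lia)
    have hx : (2 : ℝ) ^ 3 ≤ 2 ^ 3 ^ k := pow_le_pow_right₀ one_le_two hk
    norm_num at hx ⊢
    generalize (2 : ℝ) ^ 3 ^ k = y at hx
    nlinarith [mul_nonneg (sub_nonneg.2 hx) (sq_nonneg y), mul_self_nonneg (y - 8)]

open Polynomial in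
theorem orderOf_of_dvd_eval_cyclotomic {p m d k : ℕ} (hp : p.Prime) (hpd : ¬p ∣ d)
    (hm : m = p ^ k * d) (a : ℤ) (h : (p : ℤ) ∣ eval a (cyclotomic m ℤ)) :
    orderOf (a : ZMod p) = d := by
  have := Fact.mk hp
  have : NeZero (d : ZMod p) := ⟨by rwa [Ne, ZMod.natCast_eq_zero_iff]⟩
  subst hm
  refine (isRoot_cyclotomic_prime_pow_mul_iff_of_charP (k := k).1 ?_).eq_orderOf.symm
  rw [← ZMod.intCast_zmod_eq_zero_iff_dvd] at h
  rw [IsRoot, ← map_cyclotomic_int, eval_intCast_map]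
  simpa using h

theorem orderOf_zmod_dvd_iff {p : ℕ} (i : ℕ) :
    orderOf (2 : ZMod p) ∣ i ↔ p ∣ 2 ^ i - 1 := by
  rw [orderOf_dvd_iff_pow_eq_one, ← ZMod.natCast_eq_zero_iff, Nat.cast_sub Nat.one_le_two_pow,
    sub_eq_zero]
  simp

open Polynomial in
theorem not_sq_dvd_eval_two_cyclotomic {p n : ℕ} (hp : p.Prime) (hp2 : p ≠ 2) (hn : 0 < n)
    (h : p ∣ 2 ^ n - 1) :
    ¬(p : ℤ) ^ 2 ∣ eval 2 (cyclotomic (n * p) ℤ) := by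
  intro hsq
  have := Fact.mk hp
  have hdvd := eval_dvd (x := 2) (X_pow_sub_one_mul_cyclotomic_dvd_X_pow_sub_one_of_dvd ℤ
    (Nat.mem_properDivisors.2 ⟨dvd_mul_right n p, lt_mul_of_one_lt_right hn hp.one_lt⟩))
  simp only [eval_mul, eval_sub, eval_pow, eval_X, eval_one] at hdvd
  have hdvd' : (2 ^ n - 1) * p ^ 2 ∣ (2 ^ n) ^ p - 1 := by
    rw [← pow_mul, ← Int.natCast_dvd_natCast]
    push_cast [Nat.one_le_two_pow]
    exact (mul_dvd_mul_left _ hsq).trans hdvd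
  have h1 : 1 < 2 ^ n := Nat.one_lt_two_pow hn.ne'
  have h0 : 2 ^ n - 1 ≠ 0 := by lia
  have hp2n : ¬p ∣ 2 ^ n := fun h' =>
    hp2 ((Nat.prime_dvd_prime_iff_eq hp Nat.prime_two).1 (hp.dvd_of_dvd_pow h'))
  have hval := padicValNat.pow_sub_pow (hp.odd_of_ne_two hp2) h1 h hp2n hp.ne_zero
  have hne : (2 ^ n) ^ p - 1 ≠ 0 := by
    have := Nat.one_lt_pow hp.ne_zero h1
    lia
  have hle := (padicValNat_dvd_iff_le hne).1 ((pow_padicValNat_dvd (p := p)).trans hdvd')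
  rw [padicValNat.mul h0 (pow_ne_zero _ hp.ne_zero), padicValNat.prime_pow] at hle
  rw [one_pow, padicValNat_self] at hval
  lia

open Polynomial in
/-- **Zsigmondy theorem** in base two: `2` has multiplicative order `m` modulo some prime. -/
theorem exists_prime_orderOf_two_eq {m : ℕ} (hm : 2 ≤ m) (hm6 : m ≠ 6) :
    ∃ p : ℕ, p.Prime ∧ orderOf (2 : ZMod p) = m := by
  by_contra! hcon
  set c := (eval 2 (cyclotomic m ℤ)).natAbs with hc
  have hc_cast : (c : ℤ) = eval 2 (cyclotomic m ℤ) :=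
    Int.natAbs_of_nonneg (cyclotomic_nonneg m one_le_two)
  have hc1 : 1 < c := by
    simpa using sub_one_lt_natAbs_cyclotomic_eval (n := m) (q := 2) (by lia) (by lia)
  have key : ∀ p : ℕ, p.Prime → p ∣ c → ∃ d k : ℕ, m = d * p * p ^ k ∧ ¬p ∣ d ∧
      orderOf (2 : ZMod p) = d ∧ d ∣ p - 1 ∧ 2 ≤ d ∧ 3 ≤ p := by
    intro p hp hpc
    have := Fact.mk hp
    have hpe : (p : ℤ) ∣ eval 2 (cyclotomic m ℤ) := hc_cast ▸ Int.natCast_dvd_natCast.2 hpc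
    obtain ⟨k, d, hpd, hmd⟩ := Nat.exists_eq_pow_mul_and_not_dvd (by lia : m ≠ 0) p hp.ne_one
    have hord : orderOf (2 : ZMod p) = d := by
      simpa using orderOf_of_dvd_eval_cyclotomic hp hpd hmd 2 hpe
    obtain _ | k := k
    · exact absurd (hord.trans (by simpa using hmd.symm)) (hcon p hp)
    have hd0 : d ≠ 0 := by rintro rfl; simp at hpd
    have hdvd : p ∣ 2 ^ d - 1 := (orderOf_zmod_dvd_iff d).1 hord.dvd
    have hp2 : p ≠ 2 := by
      rintro rfl
      have := dvd_pow_self 2 hd0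
      have := Nat.one_le_two_pow (n := d)
      lia
    have hd1 : d ≠ 1 := by
      rintro rfl
      exact hp.one_lt.ne' (by simpa using hdvd)
    have h20 : (2 : ZMod p) ≠ 0 := by
      intro h0
      rw [h0, orderOf_zero] at hord
      lia
    have := hp.two_le
    exact ⟨d, k, by rw [hmd]; ring, hpd, hord, hord ▸ ZMod.orderOf_dvd_card_sub_one h20,
      by lia, by lia⟩
  obtain ⟨p, hp, hpc⟩ := Nat.exists_prime_and_dvd hc1.ne'
  obtain ⟨d, k, hmd, hpd, hord, hdp, hd, hp3⟩ := key p hp hpc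
  have huniq : ∀ q : ℕ, q.Prime → q ∣ c → q = p := by
    intro q hq hqc
    obtain ⟨e, l, hme, hqe, -, heq, he, hq3⟩ := key q hq hqc
    by_contra hne
    have hqm : q ∣ d * p ^ (k + 1) := ⟨e * q ^ l, by rw [pow_succ']; linarith⟩
    have hpm : p ∣ e * q ^ (l + 1) := ⟨d * p ^ k, by rw [pow_succ']; linarith⟩
    have hqd : q ∣ d := (hq.dvd_mul.1 hqm).resolve_right fun h =>
      hne ((Nat.prime_dvd_prime_iff_eq hq hp).1 (hq.dvd_of_dvd_pow h))
    have hpe : p ∣ e := (hp.dvd_mul.1 hpm).resolve_right fun h =>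
      hne ((Nat.prime_dvd_prime_iff_eq hp hq).1 (hp.dvd_of_dvd_pow h)).symm
    have := Nat.le_of_dvd (by lia) (hqd.trans hdp)
    have := Nat.le_of_dvd (by lia) (hpe.trans heq)
    lia
  have hsq : ¬p ^ 2 ∣ c := by
    rw [← Int.natCast_dvd_natCast, hc_cast, hmd, mul_right_comm, Nat.cast_pow]
    refine not_sq_dvd_eval_two_cyclotomic hp (by lia) ?_ ?_
    · have := hp.pos
      positivity
    · rw [← orderOf_zmod_dvd_iff, hord]
      exact dvd_mul_right _ _
  have hcp : c = p := by
    obtain ⟨b, hb⟩ := hpc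
    have hb1 : b = 1 := by
      by_contra hb1
      obtain ⟨q, hq, hqb⟩ := Nat.exists_prime_and_dvd hb1
      obtain rfl := huniq q hq (hb ▸ hqb.mul_left _)
      exact hsq (by rw [hb, sq]; exact mul_dvd_mul_left _ hqb)
    rw [hb, hb1, mul_one]
  have hlt : (p : ℝ) < eval 2 (cyclotomic m ℝ) := by
    rw [hmd]
    refine prime_lt_eval_two_cyclotomic hp hp3 hpd hd ?_
    by_contra! hpk
    have hp4 : p ≠ 4 := by rintro rfl; revert hp; decide
    obtain rfl : p = 3 := by lia
    obtain rfl : k = 0 := by lia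
    obtain rfl : d = 2 := le_antisymm (Nat.le_of_dvd (by lia) hdp) hd
    exact hm6 (by simpa using hmd)
  have hreal : eval 2 (cyclotomic m ℝ) = (c : ℝ) := by
    rw [← Int.cast_natCast c, hc_cast, ← map_cyclotomic_int]
    simpa using eval_intCast_map (Int.castRingHom ℝ) (cyclotomic m ℤ) 2
  rw [hreal, hcp] at hlt
  exact lt_irrefl _ hlt

theorem Nat.Prime.exists_mem_dvd_of_dvd_finset_lcm {ι : Type*} {p : ℕ} (hp : p.Prime)
    {s : Finset ι} {f : ι → ℕ} (h : p ∣ s.lcm f) : ∃ i ∈ s, p ∣ f i := by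
  obtain ⟨i, hi, hpi⟩ := (Prime.dvd_finsetProd_iff hp.prime f).1
    (h.trans (Finset.lcm_dvd fun i hi => Finset.dvd_prod_of_mem f hi))
  exact ⟨i, hi, hpi⟩

/-- If `2^(2n) - 2^n + 1` divides `gcd(2^n + 1, 3) * lcm {2^i - 1 : i = 1, …, r}`,
then `6n ≤ r`. -/
theorem psu_exponent_bound (n r : ℕ) (hn : 2 ≤ n) (hr : 1 ≤ r)
    (h : 2 ^ (2 * n) - 2 ^ n + 1 ∣
      Nat.gcd (2 ^ n + 1) 3 * (Finset.Icc 1 r).lcm (fun i => 2 ^ i - 1)) :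
    6 * n ≤ r := by
  obtain ⟨p, hp, hord⟩ := exists_prime_orderOf_two_eq (m := 6 * n) (by lia) (by lia)
  have hle : ∀ i, 1 ≤ i → p ∣ 2 ^ i - 1 → 6 * n ≤ i := fun i hi hpi =>
    Nat.le_of_dvd hi (hord ▸ (orderOf_zmod_dvd_iff i).2 hpi)
  have hfactor : (2 ^ (2 * n) - 2 ^ n + 1) * (2 ^ n + 1) * (2 ^ (3 * n) - 1) =
      2 ^ (6 * n) - 1 := by
    have h1 : 2 ^ n ≤ 2 ^ (2 * n) := Nat.pow_le_pow_right two_pos (by lia)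
    zify [h1, Nat.one_le_two_pow (n := 3 * n), Nat.one_le_two_pow (n := 6 * n)]
    ring
  have hpN : p ∣ 2 ^ (2 * n) - 2 ^ n + 1 := by
    have hdvd : p ∣ 2 ^ (6 * n) - 1 := (orderOf_zmod_dvd_iff _).1 hord.dvd
    rw [← hfactor, hp.dvd_mul, hp.dvd_mul] at hdvd
    rcases hdvd with (hdvd | hdvd) | hdvd
    · exact hdvd
    · have hplus : 2 ^ n + 1 ∣ 2 ^ (2 * n) - 1 :=
        ⟨2 ^ n - 1, by rw [mul_comm 2 n, pow_mul, ← Nat.sq_sub_sq, one_pow]⟩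
      have := hle _ (by lia) (hdvd.trans hplus)
      lia
    · have := hle _ (by lia) hdvd
      lia
  rcases hp.dvd_mul.1 (hpN.trans h) with h3 | hlcm
  · have := hle 2 (by lia) (h3.trans (Nat.gcd_dvd_right _ _))
    lia
  · obtain ⟨i, hi, hpi⟩ := hp.exists_mem_dvd_of_dvd_finset_lcm hlcm
    rw [Finset.mem_Icc] at hi
    exact (hle i hi.1 hpi).trans hi.2
end

section
/- Let P be a finite bicyclic 2-group such that the automorphism group Aut(P) is not a 2-group. Then either P is homocyclic, i.e., P is isomorphic to (ℤ/2^n ℤ) × (ℤ/2^n ℤ) for some n ≥ 1, or P is isomorphic to the quaternion group Q₈ of order 8. -/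
/-- A group is bicyclic if it is the product of two cyclic subgroups. -/
def IsBicyclic (P : Type*) [Group P] : Prop :=
  ∃ x y : P, ∀ g : P, ∃ i j : ℤ, g = x ^ i * y ^ j

open scoped commutatorElement

section Bicyclic

variable {P : Type*} [Group P]

/-- A surjective endomorphism `α` rotates the subgroups of index two if neither `α` nor `α ^ 2`
stabilizes any of them. -/
structure RotatesIndexTwo (α : P →* P) : Prop where
  surjective : Function.Surjective α
  comap_ne : ∀ L : Subgroup P, L.index = 2 → L.comap α ≠ L
  comap_comap_ne : ∀ L : Subgroup P, L.index = 2 → (L.comap α).comap α ≠ L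

theorem index_two_not_mem {x y : P} (hxy : Subgroup.closure {x, y} = ⊤) {L : Subgroup P}
    (hL : L.index = 2) (hx : x ∈ L) : y ∉ L := by
  intro hy
  have : (⊤ : Subgroup P) ≤ L := by
    rw [← hxy, Subgroup.closure_le]
    rintro z (rfl | rfl) <;> assumption
  rw [top_le_iff] at this
  simp [this] at hL

theorem index_two_ext {x y : P} (hxy : Subgroup.closure {x, y} = ⊤) {L M : Subgroup P}
    (hL : L.index = 2) (hM : M.index = 2) (hx : x ∈ L ↔ x ∈ M) (hy : y ∈ L ↔ y ∈ M) :
    L = M := by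
  ext g
  have hg : g ∈ Subgroup.closure {x, y} := hxy ▸ Subgroup.mem_top g
  induction hg using Subgroup.closure_induction with
  | mem z hz => rcases hz with rfl | rfl <;> assumption
  | one => simp [one_mem]
  | mul a b _ _ ha hb =>
    rw [Subgroup.mul_mem_iff_of_index_two hL, Subgroup.mul_mem_iff_of_index_two hM]
    exact iff_congr ha hb
  | inv a _ ha => simpa using ha

/-- A two-generated group has at most three subgroups of index two. -/
theorem index_two_eq_or {x y : P} (hxy : Subgroup.closure {x, y} = ⊤) {L₁ L₂ L₃ L : Subgroup P}
    (h₁ : L₁.index = 2) (h₂ : L₂.index = 2) (h₃ : L₃.index = 2) (h : L.index = 2)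
    (h₁₂ : L₁ ≠ L₂) (h₁₃ : L₁ ≠ L₃) (h₂₃ : L₂ ≠ L₃) : L = L₁ ∨ L = L₂ ∨ L = L₃ := by
  have e₁₂ := mt (fun H ↦ index_two_ext hxy h₁ h₂ (And.left H) H.2) h₁₂
  have e₁₃ := mt (fun H ↦ index_two_ext hxy h₁ h₃ (And.left H) H.2) h₁₃
  have e₂₃ := mt (fun H ↦ index_two_ext hxy h₂ h₃ (And.left H) H.2) h₂₃
  have e₁ := fun H H' ↦ index_two_ext hxy h h₁ H H'
  have e₂ := fun H H' ↦ index_two_ext hxy h h₂ H H'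
  have e₃ := fun H H' ↦ index_two_ext hxy h h₃ H H'
  have n₁ := index_two_not_mem hxy h₁
  have n₂ := index_two_not_mem hxy h₂
  have n₃ := index_two_not_mem hxy h₃
  have n := index_two_not_mem hxy h
  by_cases x ∈ L₁ <;> by_cases x ∈ L₂ <;> by_cases x ∈ L₃ <;> by_cases x ∈ L <;> simp_all <;>
    by_cases y ∈ L₁ <;> by_cases y ∈ L₂ <;> by_cases y ∈ L₃ <;> by_cases y ∈ L <;> simp_all

theorem exists_index_two_le [Finite P] (hP : IsPGroup 2 P) {S : Subgroup P} (hS : S ≠ ⊤) :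
    ∃ L : Subgroup P, L.index = 2 ∧ S ≤ L := by
  obtain ⟨m, hm⟩ := IsPGroup.iff_card.mp hP
  obtain ⟨k, hk⟩ := IsPGroup.iff_card.mp (hP.to_subgroup S)
  have hkm : k < m := by
    by_contra! h
    refine hS (S.eq_top_of_le_card ?_)
    rw [hm, hk]
    exact Nat.pow_le_pow_right two_pos h
  obtain ⟨L, hL, hSL⟩ := Sylow.exists_subgroup_card_pow_prime_le (n := k) (m := m - 1) 2
    (by rw [hm]; exact pow_dvd_pow 2 (by omega)) S hk (by omega)
  refine ⟨L, ?_, hSL⟩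
  have h := L.card_mul_index
  rw [hL, hm, ← Nat.sub_add_cancel (show 1 ≤ m by omega), pow_succ, Nat.add_sub_cancel] at h
  exact Nat.eq_of_mul_eq_mul_left (by positivity) h

namespace RotatesIndexTwo

variable {α : P →* P}

theorem ne_comap_comap (hα : RotatesIndexTwo α) {L : Subgroup P} (hL : L.index = 2) :
    L.comap α ≠ (L.comap α).comap α :=
  fun h ↦ hα.comap_ne L hL (Subgroup.comap_injective hα.surjective h).symm

theorem index_comap (hα : RotatesIndexTwo α) {L : Subgroup P} (hL : L.index = 2) :
    (L.comap α).index = 2 := by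
  rw [Subgroup.index_comap_of_surjective L hα.surjective, hL]

theorem index_two_eq_or (hα : RotatesIndexTwo α) {x y : P} (hxy : Subgroup.closure {x, y} = ⊤)
    {L M : Subgroup P} (hL : L.index = 2) (hM : M.index = 2) :
    M = L ∨ M = L.comap α ∨ M = (L.comap α).comap α :=
  _root_.index_two_eq_or hxy hL (hα.index_comap hL) (hα.index_comap (hα.index_comap hL)) hM
    (hα.comap_ne L hL).symm (hα.comap_comap_ne L hL).symm (hα.ne_comap_comap hL)

/-- Proper invariant subgroups lie in every subgroup of index two, so in the Frattini subgroup. -/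
theorem le_of_index_two [Finite P] (hα : RotatesIndexTwo α) (hP : IsPGroup 2 P) {x y : P}
    (hxy : Subgroup.closure {x, y} = ⊤) {S : Subgroup P} (hS : S ≠ ⊤) (hSα : S ≤ S.comap α)
    {M : Subgroup P} (hM : M.index = 2) : S ≤ M := by
  obtain ⟨L, hL, hSL⟩ := exists_index_two_le hP hS
  have h₁ : S ≤ L.comap α := hSα.trans (Subgroup.comap_mono hSL)
  have h₂ : S ≤ (L.comap α).comap α := hSα.trans (Subgroup.comap_mono h₁)
  rcases hα.index_two_eq_or hxy hL hM with rfl | rfl | rfl <;> assumption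

theorem exists_index_two [Finite P] [Nontrivial P] (hα : RotatesIndexTwo α) (hP : IsPGroup 2 P)
    {x y : P} (hxy : Subgroup.closure {x, y} = ⊤) :
    (∃ L : Subgroup P, L.index = 2 ∧ x ∈ L ∧ y ∉ L) ∧
      ∃ L : Subgroup P, L.index = 2 ∧ x ∉ L ∧ y ∈ L := by
  obtain ⟨L, hL, -⟩ := exists_index_two_le hP (bot_ne_top : (⊥ : Subgroup P) ≠ ⊤)
  have hL₁ := hα.index_comap hL
  have hL₂ := hα.index_comap hL₁
  have e₁ := mt (fun H ↦ index_two_ext hxy hL hL₁ (And.left H) H.2) (hα.comap_ne L hL).symm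
  have e₂ := mt (fun H ↦ index_two_ext hxy hL hL₂ (And.left H) H.2) (hα.comap_comap_ne L hL).symm
  have e₃ := mt (fun H ↦ index_two_ext hxy hL₁ hL₂ (And.left H) H.2) (hα.ne_comap_comap hL)
  have n := index_two_not_mem hxy hL
  have n₁ := index_two_not_mem hxy hL₁
  have n₂ := index_two_not_mem hxy hL₂
  suffices (x ∈ L ∧ y ∉ L ∨ x ∈ L.comap α ∧ y ∉ L.comap α ∨
      x ∈ (L.comap α).comap α ∧ y ∉ (L.comap α).comap α) ∧
      (x ∉ L ∧ y ∈ L ∨ x ∉ L.comap α ∧ y ∈ L.comap α ∨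
      x ∉ (L.comap α).comap α ∧ y ∈ (L.comap α).comap α) by
    refine this.imp ?_ ?_ <;>
    · rintro (h | h | h)
      exacts [⟨_, hL, h⟩, ⟨_, hL₁, h⟩, ⟨_, hL₂, h⟩]
  generalize L.comap α = L₁ at *
  generalize L₁.comap α = L₂ at *
  clear hL hL₁ hL₂
  by_cases x ∈ L <;> by_cases x ∈ L₁ <;> by_cases x ∈ L₂ <;> simp_all <;> tauto

theorem zpow_mem_of_index_two {L : Subgroup P} (hL : L.index = 2) {y : P} (hy : y ∉ L) {j : ℤ}
    (h : y ^ j ∈ L) : Even j := by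
  by_contra hj
  obtain ⟨k, rfl⟩ := Int.not_even_iff_odd.mp hj
  rw [zpow_add, zpow_mul, zpow_one, Subgroup.mul_mem_iff_of_index_two hL] at h
  refine hy (h.mp (zpow_mem ?_ k))
  exact_mod_cast Subgroup.sq_mem_of_index_two hL y

theorem even_of_mem [Finite P] (hα : RotatesIndexTwo α) (hP : IsPGroup 2 P) {x y : P}
    (hxy : Subgroup.closure {x, y} = ⊤) {S : Subgroup P} (hS : S ≠ ⊤) (hSα : S ≤ S.comap α)
    {i j : ℤ} (h : x ^ i * y ^ j ∈ S) : Even i ∧ Even j := by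
  have : Nontrivial P := by
    by_contra H
    rw [not_nontrivial_iff_subsingleton] at H
    exact hS (Subsingleton.elim _ _)
  obtain ⟨⟨L, hL, hx, hy⟩, M, hM, hx', hy'⟩ := hα.exists_index_two hP hxy
  have h₁ := hα.le_of_index_two hP hxy hS hSα hL h
  have h₂ := hα.le_of_index_two hP hxy hS hSα hM h
  rw [Subgroup.mul_mem_cancel_left _ (zpow_mem hx i)] at h₁
  rw [Subgroup.mul_mem_cancel_right _ (zpow_mem hy' j)] at h₂
  exact ⟨zpow_mem_of_index_two hM hx' h₂, zpow_mem_of_index_two hL hy h₁⟩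

theorem map_quotient (hα : RotatesIndexTwo α) (N : Subgroup P) [N.Normal] (hN : N ≤ N.comap α) :
    RotatesIndexTwo (QuotientGroup.map N N α hN) := by
  have hs : Function.Surjective (QuotientGroup.mk' N) := QuotientGroup.mk'_surjective N
  have hc : ∀ L : Subgroup (P ⧸ N), (L.comap (QuotientGroup.map N N α hN)).comap
      (QuotientGroup.mk' N) = (L.comap (QuotientGroup.mk' N)).comap α := fun L ↦ rfl
  have hi : ∀ L : Subgroup (P ⧸ N), L.index = 2 → (L.comap (QuotientGroup.mk' N)).index = 2 :=
    fun L hL ↦ by rw [Subgroup.index_comap_of_surjective L hs, hL]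
  refine ⟨fun q ↦ ?_, fun L hL h ↦ ?_, fun L hL h ↦ ?_⟩
  · obtain ⟨g, rfl⟩ := hs q
    obtain ⟨g, rfl⟩ := hα.surjective g
    exact ⟨QuotientGroup.mk' N g, rfl⟩
  · exact hα.comap_ne _ (hi L hL) (by rw [← hc, h])
  · exact hα.comap_comap_ne _ (hi L hL) (by rw [← hc, ← hc, h])

/-- In the abelian case the two generators form a basis over `ℤ / 2 ^ n`. -/
theorem exists_pow_eq_one [Finite P] (hα : RotatesIndexTwo α) (hP : IsPGroup 2 P) {x y : P}
    (hxy : Subgroup.closure {x, y} = ⊤) (hcomm : ∀ a b : P, a * b = b * a) :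
    ∃ n : ℕ, (∀ g : P, g ^ 2 ^ n = 1) ∧
      ∀ i j : ℤ, x ^ i * y ^ j = 1 → (2 : ℤ) ^ n ∣ i ∧ (2 : ℤ) ^ n ∣ j := by
  classical
  have hex : ∃ n : ℕ, ∀ g : P, g ^ 2 ^ n = 1 := by
    obtain ⟨n, hn⟩ := IsPGroup.iff_card.mp hP
    exact ⟨n, fun g ↦ hn ▸ pow_card_eq_one'⟩
  refine ⟨Nat.find hex, Nat.find_spec hex, fun i j hij ↦ ?_⟩
  suffices ∀ k ≤ Nat.find hex, (2 : ℤ) ^ k ∣ i ∧ (2 : ℤ) ^ k ∣ j from this _ le_rfl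
  intro k
  induction k with
  | zero => simp
  | succ k ih =>
    intro hk
    obtain ⟨⟨i', rfl⟩, j', rfl⟩ := ih (by omega)
    obtain ⟨m, hm⟩ : ∃ m, Nat.find hex = m + 1 := ⟨Nat.find hex - 1, by omega⟩
    let K : Subgroup P :=
      { carrier := {g | g ^ 2 ^ m = 1}
        one_mem' := by simp
        mul_mem' := fun {a b} ha hb ↦ by
          have ha : a ^ 2 ^ m = 1 := ha
          have hb : b ^ 2 ^ m = 1 := hb
          change (a * b) ^ 2 ^ m = 1
          rw [(show Commute a b from hcomm a b).mul_pow, ha, hb, one_mul]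
        inv_mem' := fun {a} ha ↦ by
          have ha : a ^ 2 ^ m = 1 := ha
          change a⁻¹ ^ 2 ^ m = 1
          rw [inv_pow, ha, inv_one] }
    have hK : K ≠ ⊤ := fun h ↦ Nat.find_min hex (m := m) (by omega) fun g ↦
      show g ∈ K from h ▸ Subgroup.mem_top g
    have hKα : K ≤ K.comap α := fun g (hg : g ^ 2 ^ m = 1) ↦ show α g ^ 2 ^ m = 1 by
      rw [← map_pow, hg, map_one]
    have hmem : x ^ i' * y ^ j' ∈ K := by
      have h : (x ^ i' * y ^ j') ^ 2 ^ k = 1 := by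
        rw [(show Commute _ _ from hcomm _ _).mul_pow, ← hij, ← zpow_natCast, ← zpow_natCast,
          ← zpow_mul, ← zpow_mul]
        push_cast
        rw [mul_comm i', mul_comm j']
      change (x ^ i' * y ^ j') ^ 2 ^ m = 1
      obtain ⟨d, hd⟩ : 2 ^ k ∣ 2 ^ m := pow_dvd_pow 2 (by omega)
      rw [hd, pow_mul, h, one_pow]
    obtain ⟨hi, hj⟩ := hα.even_of_mem hP hxy hK hKα hmem
    rw [pow_succ]
    exact ⟨mul_dvd_mul_left _ hi.two_dvd, mul_dvd_mul_left _ hj.two_dvd⟩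

end RotatesIndexTwo

theorem closure_eq_top_of_bicyclic {x y : P} (h : ∀ g : P, ∃ i j : ℤ, g = x ^ i * y ^ j) :
    Subgroup.closure {x, y} = ⊤ := by
  refine eq_top_iff.mpr fun g _ ↦ ?_
  obtain ⟨i, j, rfl⟩ := h g
  exact mul_mem (zpow_mem (Subgroup.subset_closure (by simp)) i)
    (zpow_mem (Subgroup.subset_closure (by simp)) j)

theorem bicyclic_quotient {x y : P} (h : ∀ g : P, ∃ i j : ℤ, g = x ^ i * y ^ j) (N : Subgroup P)
    [N.Normal] (q : P ⧸ N) : ∃ i j : ℤ, q = (x : P ⧸ N) ^ i * (y : P ⧸ N) ^ j := by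
  obtain ⟨g, rfl⟩ := QuotientGroup.mk_surjective q
  obtain ⟨i, j, rfl⟩ := h g
  exact ⟨i, j, rfl⟩

theorem mem_center_of_commute {x y z : P} (hxy : Subgroup.closure {x, y} = ⊤)
    (hx : Commute z x) (hy : Commute z y) : z ∈ Subgroup.center P := by
  have : (⊤ : Subgroup P) ≤ Subgroup.centralizer {z} := by
    rw [← hxy, Subgroup.closure_le]
    rintro w (rfl | rfl)
    · exact Subgroup.mem_centralizer_singleton_iff.mpr hx.symm
    · exact Subgroup.mem_centralizer_singleton_iff.mpr hy.symm
  exact Subgroup.mem_center_iff.mpr fun g ↦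
    Subgroup.mem_centralizer_singleton_iff.mp (this (Subgroup.mem_top g))

theorem commute_of_generators {x y : P} (hxy : Subgroup.closure {x, y} = ⊤) (h : Commute x y)
    (a b : P) : a * b = b * a := by
  have hx := mem_center_of_commute hxy (Commute.refl x) h
  have hy := mem_center_of_commute hxy h.symm (Commute.refl y)
  have : (⊤ : Subgroup P) ≤ Subgroup.center P := by
    rw [← hxy, Subgroup.closure_le]
    rintro w (rfl | rfl) <;> assumption
  exact Subgroup.mem_center_iff.mp (this (Subgroup.mem_top b)) a

theorem commutator_sq_of_sq_central {x y : P} (hc : ⁅x, y⁆ ∈ Subgroup.center P)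
    (hx : x ^ 2 ∈ Subgroup.center P) : ⁅x, y⁆ ^ 2 = 1 := by
  have e : x * y = ⁅x, y⁆ * (y * x) := by simp [commutatorElement_def, mul_assoc]
  have hcx := Subgroup.mem_center_iff.mp hc x
  have hxy := Subgroup.mem_center_iff.mp hx y
  generalize ⁅x, y⁆ = c at *
  have : c ^ 2 * (y * x ^ 2) = y * x ^ 2 := by
    calc c ^ 2 * (y * x ^ 2) = c * (c * (y * x)) * x := by simp only [sq, mul_assoc]
      _ = (c * x) * y * x := by rw [← e]; simp only [mul_assoc]
      _ = x * (c * (y * x)) := by rw [← hcx]; simp only [mul_assoc]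
      _ = x ^ 2 * y := by rw [← e, sq, mul_assoc]
      _ = y * x ^ 2 := hxy.symm
  simpa using this

theorem sq_commute_of_commutator_sq {x y : P} (hc : ⁅x, y⁆ ∈ Subgroup.center P)
    (hc2 : ⁅x, y⁆ ^ 2 = 1) : Commute (x ^ 2) y := by
  have e : x * y = ⁅x, y⁆ * (y * x) := by simp [commutatorElement_def, mul_assoc]
  have hcx := Subgroup.mem_center_iff.mp hc x
  generalize ⁅x, y⁆ = c at *
  calc x ^ 2 * y = x * (c * (y * x)) := by rw [← e, sq, mul_assoc]
    _ = (c * x) * y * x := by rw [← hcx]; simp only [mul_assoc]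
    _ = c * (c * (y * x)) * x := by rw [← e]; simp only [mul_assoc]
    _ = c ^ 2 * (y * x ^ 2) := by simp only [sq, mul_assoc]
    _ = y * x ^ 2 := by rw [hc2, one_mul]

theorem mul_sq_of_commutator_sq {x y : P} (hc : ⁅x, y⁆ ∈ Subgroup.center P)
    (hc2 : ⁅x, y⁆ ^ 2 = 1) : (x * y) ^ 2 = ⁅x, y⁆ * (x ^ 2 * y ^ 2) := by
  have e : x * y = ⁅x, y⁆ * (y * x) := by simp [commutatorElement_def, mul_assoc]
  have hcx := Subgroup.mem_center_iff.mp hc x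
  generalize ⁅x, y⁆ = c at *
  have e' : y * x = c * (x * y) := by rw [e, ← mul_assoc, ← sq, hc2, one_mul]
  calc (x * y) ^ 2 = x * (y * x) * y := by simp only [sq, mul_assoc]
    _ = x * c * x * y * y := by rw [e']; simp only [mul_assoc]
    _ = c * (x ^ 2 * y ^ 2) := by rw [hcx]; simp only [sq, mul_assoc]

theorem mul_pow_four {a b : P} (hc : ⁅a, b⁆ ∈ Subgroup.center P)
    (hc2 : ⁅a, b⁆ ^ 2 = 1) : (a * b) ^ 4 = a ^ 4 * b ^ 4 := by
  have h₁ : Commute (a ^ 2) (b ^ 2) := (sq_commute_of_commutator_sq hc hc2).pow_right 2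
  have h₂ : Commute ⁅a, b⁆ (a ^ 2 * b ^ 2) := (Subgroup.mem_center_iff.mp hc _).symm
  rw [show 4 = 2 * 2 from rfl, pow_mul, mul_sq_of_commutator_sq hc hc2, h₂.mul_pow, hc2, one_mul,
    h₁.mul_pow, ← pow_mul, ← pow_mul]

/-- The elements of square different from one generate a characteristic subgroup, which is cyclic
in a dihedral group. -/
theorem RotatesIndexTwo.sq_eq_one_of_dihedral [Finite P] {α : P →* P} (hα : RotatesIndexTwo α)
    (hP : IsPGroup 2 P) {x y : P} (hxy : Subgroup.closure {x, y} = ⊤) (hx : x ^ 2 = 1)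
    (hconj : x * y * x⁻¹ = y⁻¹) : y ^ 2 = 1 := by
  by_contra hy
  have hx' : x⁻¹ = x := inv_eq_of_mul_eq_one_right (by rw [← sq, hx])
  have hyx : ∀ j : ℤ, y ^ j * x = x * y ^ (-j) := fun j ↦ by
    rw [zpow_neg, ← inv_zpow, ← hconj, conj_zpow, hx', ← mul_assoc, ← mul_assoc, ← sq, hx,
      one_mul]
  have hform : ∀ g : P, ∃ j : ℤ, g = y ^ j ∨ g = x * y ^ j := fun g ↦ by
    have hg : g ∈ Subgroup.closure {x, y} := hxy ▸ Subgroup.mem_top g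
    induction hg using Subgroup.closure_induction with
    | mem z hz =>
      rcases hz with rfl | rfl
      · exact ⟨0, Or.inr (by simp)⟩
      · exact ⟨1, Or.inl (by simp)⟩
    | one => exact ⟨0, Or.inl (by simp)⟩
    | mul a b _ _ ha hb =>
      obtain ⟨j, rfl | rfl⟩ := ha <;> obtain ⟨k, rfl | rfl⟩ := hb
      · exact ⟨j + k, Or.inl (zpow_add y j k).symm⟩
      · exact ⟨-j + k, Or.inr (by rw [← mul_assoc, hyx, mul_assoc, zpow_add])⟩
      · exact ⟨j + k, Or.inr (by rw [mul_assoc, zpow_add])⟩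
      · exact ⟨-j + k, Or.inl (by
          rw [mul_assoc, ← mul_assoc (y ^ j), hyx, mul_assoc x, ← mul_assoc x, ← sq, hx, one_mul,
            zpow_add])⟩
    | inv a _ ha =>
      obtain ⟨j, rfl | rfl⟩ := ha
      · exact ⟨-j, Or.inl (zpow_neg y j).symm⟩
      · exact ⟨j, Or.inr (by rw [mul_inv_rev, hx', ← zpow_neg, hyx, neg_neg])⟩
  have hle : Subgroup.closure {g : P | g ^ 2 ≠ 1} ≤ Subgroup.zpowers y := by
    rw [Subgroup.closure_le]
    intro g hg
    obtain ⟨j, rfl | rfl⟩ := hform g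
    · exact Subgroup.zpow_mem_zpowers y j
    · refine absurd ?_ hg
      rw [sq, mul_assoc, ← mul_assoc (y ^ j), hyx, mul_assoc x, ← mul_assoc x, ← sq, hx, one_mul,
        ← zpow_add, neg_add_cancel, zpow_zero]
  by_cases htop : Subgroup.closure {g : P | g ^ 2 ≠ 1} = ⊤
  · obtain ⟨k, hk⟩ := Subgroup.mem_zpowers_iff.mp (hle (htop ▸ Subgroup.mem_top x))
    have : x * y * x⁻¹ = y := by
      rw [← hk, ← zpow_add_one, add_comm, zpow_one_add, mul_inv_cancel_right]
    rw [this] at hconj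
    exact hy (by rw [sq]; nth_rw 1 [hconj]; exact inv_mul_cancel y)
  · have hinj : Function.Injective α := Finite.injective_iff_surjective.mpr hα.surjective
    have h := hα.even_of_mem hP hxy htop (i := 0) (j := 1)
      ((Subgroup.closure_le _).mpr fun g (hg : g ^ 2 ≠ 1) ↦ Subgroup.subset_closure
        (show α g ^ 2 ≠ 1 by rwa [← map_pow, Ne, map_eq_one_iff α hinj]))
      (Subgroup.subset_closure (by simpa using hy))
    simp at h

theorem eq_one_or_eq_of_mem_zpowers {c z : P} (hc : c ^ 2 = 1) (hz : z ∈ Subgroup.zpowers c) :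
    z = 1 ∨ z = c := by
  obtain ⟨k, rfl⟩ := Subgroup.mem_zpowers_iff.mp hz
  have hc' : c ^ (2 : ℤ) = 1 := by exact_mod_cast hc
  rcases Int.even_or_odd' k with ⟨m, rfl | rfl⟩
  · simp [zpow_mul, hc']
  · simp [zpow_add, zpow_mul, hc']

theorem sq_eq_commutator [Finite P] {α : P →* P} (hα : RotatesIndexTwo α) (hP : IsPGroup 2 P)
    {x y : P} (h : ∀ g : P, ∃ i j : ℤ, g = x ^ i * y ^ j) (hc : ⁅x, y⁆ ∈ Subgroup.center P)
    (hc2 : ⁅x, y⁆ ^ 2 = 1) (hc1 : ⁅x, y⁆ ≠ 1) : ⁅x, y⁆ = x ^ 2 ∧ ⁅x, y⁆ = y ^ 2 := by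
  have hxy := closure_eq_top_of_bicyclic h
  let M : Subgroup P := Subgroup.zpowers ⁅x, y⁆
  have hMc : M ≤ Subgroup.center P := Subgroup.zpowers_le.mpr hc
  have hM : ∀ z ∈ M, z = 1 ∨ z = ⁅x, y⁆ := fun z ↦ eq_one_or_eq_of_mem_zpowers hc2
  have : M.Normal := ⟨fun n hn g ↦ by
    rwa [Subgroup.mem_center_iff.mp (hMc hn) g, mul_inv_cancel_right]⟩
  have hxyM := closure_eq_top_of_bicyclic (bicyclic_quotient h M)
  have hcomm : ∀ a b : P ⧸ M, a * b = b * a := commute_of_generators hxyM <| by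
    rw [← commutatorElement_eq_one_iff_commute]
    exact (QuotientGroup.eq_one_iff ⁅x, y⁆).mpr (Subgroup.mem_zpowers _)
  have hcommM : ∀ a b : P, ⁅a, b⁆ ∈ M := fun a b ↦ by
    rw [← QuotientGroup.eq_one_iff]
    exact commutatorElement_eq_one_iff_mul_comm.mpr (hcomm a b)
  have hMα : M ≤ M.comap α := by
    rw [Subgroup.zpowers_le, Subgroup.mem_comap, map_commutatorElement]
    exact hcommM _ _
  obtain ⟨n, hn, hind⟩ := (hα.map_quotient M hMα).exists_pow_eq_one (hP.to_quotient M) hxyM hcomm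
  have hpow : ∀ g : P, g ^ 2 ^ n = 1 ∨ g ^ 2 ^ n = ⁅x, y⁆ := fun g ↦ by
    refine hM _ ?_
    rw [← QuotientGroup.eq_one_iff]
    exact hn g
  have hne : x ^ 2 ^ n = 1 → y ^ 2 ^ n = 1 → False := fun hx hy ↦ by
    obtain ⟨i, j, hij⟩ := h ⁅x, y⁆
    obtain ⟨⟨i, rfl⟩, j, rfl⟩ := hind i j <| by
      have : ((⁅x, y⁆ : P) : P ⧸ M) = 1 :=
        (QuotientGroup.eq_one_iff _).mpr (Subgroup.mem_zpowers _)
      rw [← this, hij]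
      rfl
    have hx' : x ^ (2 : ℤ) ^ n = 1 := by exact_mod_cast hx
    have hy' : y ^ (2 : ℤ) ^ n = 1 := by exact_mod_cast hy
    rw [zpow_mul, zpow_mul, hx', hy'] at hij
    exact hc1 (by simpa using hij)
  match n with
  | 0 =>
    have hx : Commute x y := by
      rcases hpow x with hx | hx
      · rw [pow_zero, pow_one] at hx
        simp [hx]
      · rw [pow_zero, pow_one] at hx
        exact (Subgroup.mem_center_iff.mp (hx ▸ hc) y).symm
    exact absurd (commutatorElement_eq_one_iff_commute.mpr hx) hc1
  | 1 =>
    rw [pow_one] at hpow hne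
    have hc4 : ⁅x, y⁆ * ⁅x, y⁆ = 1 := by rw [← sq, hc2]
    rcases hpow x with hx | hx <;> rcases hpow y with hy | hy
    · exact (hne hx hy).elim
    · refine absurd ?_ hc1
      rw [← hy]
      refine hα.sq_eq_one_of_dihedral hP hxy hx ?_
      rw [eq_inv_iff_mul_eq_one, ← hc4]
      nth_rw 2 [← hy]
      simp [commutatorElement_def, sq, mul_assoc]
    · refine absurd ?_ hc1
      rw [← hx]
      refine hα.sq_eq_one_of_dihedral hP (by rwa [Set.pair_comm]) hy ?_
      rw [commutatorElement_def, sq, mul_assoc, mul_assoc, mul_right_inj, ← mul_assoc] at hx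
      simpa [mul_assoc] using (congrArg (·⁻¹) hx).symm
    · exact ⟨hx.symm, hy.symm⟩
  | m + 2 =>
    have hmul : ∀ a b : P, (a * b) ^ 2 ^ (m + 2) = a ^ 2 ^ (m + 2) * b ^ 2 ^ (m + 2) := by
      intro a b
      have h₂ : ⁅a, b⁆ ^ 2 = 1 := by
        rcases hM _ (hcommM a b) with h | h
        · rw [h, one_pow]
        · rw [h, hc2]
      have h₃ : Commute (a ^ 4) (b ^ 4) := by
        have := (sq_commute_of_commutator_sq (hMc (hcommM a b)) h₂).pow_pow 2 4
        rwa [← pow_mul] at this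
      rw [show 2 ^ (m + 2) = 4 * 2 ^ m by ring, pow_mul, mul_pow_four (hMc (hcommM a b)) h₂,
        h₃.mul_pow, ← pow_mul, ← pow_mul]
    let K : Subgroup P := (MonoidHom.mk' (fun g : P ↦ g ^ 2 ^ (m + 2)) hmul).ker
    have hKmem : ∀ g, g ∈ K ↔ g ^ 2 ^ (m + 2) = 1 := fun g ↦ MonoidHom.mem_ker
    have hK : K ≠ ⊤ := fun hK ↦
      hne ((hKmem x).mp (hK ▸ Subgroup.mem_top x)) ((hKmem y).mp (hK ▸ Subgroup.mem_top y))
    have hKα : K ≤ K.comap α := fun g hg ↦ by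
      rw [Subgroup.mem_comap, hKmem, ← map_pow, (hKmem g).mp hg, map_one]
    have heven := fun i j ↦ hα.even_of_mem hP hxy hK hKα (i := i) (j := j)
    simp only [hKmem] at heven
    rcases hpow x with hx | hx
    · simpa using heven 1 0 (by simpa using hx)
    · rcases hpow y with hy | hy
      · simpa using heven 0 1 (by simpa using hy)
      · simpa using heven 1 1 (by simpa [hmul, hx, hy, sq] using hc2)

theorem commutator_eq_one_or_sq_eq (m : ℕ) : ∀ (P : Type*) [Group P] [Finite P], Nat.card P = m →
    IsPGroup 2 P → ∀ (α : P →* P), RotatesIndexTwo α → ∀ x y : P,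
    (∀ g : P, ∃ i j : ℤ, g = x ^ i * y ^ j) →
    ⁅x, y⁆ = 1 ∨ ⁅x, y⁆ = x ^ 2 ∧ ⁅x, y⁆ = y ^ 2 := by
  induction m using Nat.strong_induction_on with
  | _ m ih =>
  intro P _ _ hm hP α hα x y h
  rcases subsingleton_or_nontrivial P with hsub | hnt
  · exact Or.inl (Subsingleton.elim _ _)
  have hxy := closure_eq_top_of_bicyclic h
  let N : Subgroup P :=
    { carrier := {z | z ∈ Subgroup.center P ∧ z ^ 2 = 1}
      one_mem' := ⟨one_mem _, one_pow 2⟩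
      mul_mem' := fun {a b} ha hb ↦ ⟨mul_mem ha.1 hb.1, by
        rw [(show Commute a b from Subgroup.mem_center_iff.mp hb.1 a).mul_pow, ha.2, hb.2, one_mul]⟩
      inv_mem' := fun {a} ha ↦ ⟨inv_mem ha.1, by rw [inv_pow, ha.2, inv_one]⟩ }
  have hNc : N ≤ Subgroup.center P := fun z hz ↦ hz.1
  have : N.Normal := ⟨fun n hn g ↦ by
    rwa [Subgroup.mem_center_iff.mp (hNc hn) g, mul_inv_cancel_right]⟩
  have hNα : N ≤ N.comap α := fun z hz ↦ ⟨Subgroup.mem_center_iff.mpr fun g ↦ by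
    obtain ⟨g, rfl⟩ := hα.surjective g
    rw [← map_mul, ← map_mul, Subgroup.mem_center_iff.mp hz.1 g], by rw [← map_pow, hz.2, map_one]⟩
  have hN1 : N ≠ ⊥ := by
    have := hP.center_nontrivial
    obtain ⟨k, hk, hcard⟩ := (hP.to_subgroup (Subgroup.center P)).nontrivial_iff_card.mp this
    obtain ⟨z, hz⟩ := exists_prime_orderOf_dvd_card' (G := Subgroup.center P) 2
      (hcard ▸ dvd_pow_self 2 hk.ne')
    have hz2 : (z : P) ^ 2 = 1 := by
      rw [← Subgroup.coe_pow, ← hz, pow_orderOf_eq_one, Subgroup.coe_one]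
    intro hbot
    have hz1 : (z : P) ∈ N := ⟨z.2, hz2⟩
    rw [hbot, Subgroup.mem_bot, OneMemClass.coe_eq_one] at hz1
    simp [hz1] at hz
  have hlt : Nat.card (P ⧸ N) < m := by
    rw [← hm, N.card_eq_card_quotient_mul_card_subgroup]
    exact lt_mul_of_one_lt_right Nat.card_pos ((Subgroup.one_lt_card_iff_ne_bot N).mpr hN1)
  have key := ih _ hlt (P ⧸ N) rfl (hP.to_quotient N) _ (hα.map_quotient N hNα) x y
    (bicyclic_quotient h N)
  have hc : ⁅x, y⁆ ∈ Subgroup.center P ∧ ⁅x, y⁆ ^ 2 = 1 := by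
    rcases key with key | ⟨hx, hy⟩
    · exact (QuotientGroup.eq_one_iff ⁅x, y⁆).mp key
    · have hx : (x ^ 2)⁻¹ * ⁅x, y⁆ ∈ N := QuotientGroup.eq.mp hx.symm
      have hy : (y ^ 2)⁻¹ * ⁅x, y⁆ ∈ N := QuotientGroup.eq.mp hy.symm
      have hcomm : ∀ z : P, (z ^ 2)⁻¹ * ⁅x, y⁆ ∈ N → Commute ⁅x, y⁆ z := fun z hz ↦ by
        have h₁ : Commute ((z ^ 2)⁻¹ * ⁅x, y⁆) z := (Subgroup.mem_center_iff.mp (hNc hz) z).symm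
        have h₂ : Commute (z ^ 2) z := Commute.pow_self z 2
        simpa using h₂.mul_left h₁
      have hcc := mem_center_of_commute hxy (hcomm x hx) (hcomm y hy)
      refine ⟨hcc, commutator_sq_of_sq_central hcc ?_⟩
      have := mul_mem hcc (inv_mem (hNc hx))
      rwa [mul_inv_rev, inv_inv, mul_inv_cancel_left] at this
  by_cases hc1 : ⁅x, y⁆ = 1
  · exact Or.inl hc1
  · exact Or.inr (sq_eq_commutator hα hP h hc.1 hc.2 hc1)

theorem comap_iterate (α : MulAut P) (k : ℕ) (L : Subgroup P) :
    (fun M : Subgroup P ↦ M.comap (MulEquiv.toMonoidHom α))^[k] L =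
      L.comap (MulEquiv.toMonoidHom (α ^ k)) := by
  induction k with
  | zero => rfl
  | succ k ih => rw [Function.iterate_succ_apply', ih, pow_succ]; rfl

theorem rotatesIndexTwo_of_prime [Finite P] (hP : IsPGroup 2 P) {x y : P}
    (hxy : Subgroup.closure {x, y} = ⊤) {α : MulAut P} {p : ℕ} (hp : p.Prime) (hp2 : p ≠ 2)
    (hαp : α ^ p = 1) (hα : α ≠ 1) : RotatesIndexTwo (MulEquiv.toMonoidHom α) := by
  classical
  have hs : Function.Surjective (MulEquiv.toMonoidHom α) := MulEquiv.surjective α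
  have hinj := Subgroup.comap_injective hs
  have hidx : ∀ L : Subgroup P, L.index = 2 → (L.comap (MulEquiv.toMonoidHom α)).index = 2 :=
    fun L hL ↦ by rw [Subgroup.index_comap_of_surjective L hs, hL]
  have hper : ∀ L : Subgroup P, (L.comap (MulEquiv.toMonoidHom α)).comap
      (MulEquiv.toMonoidHom α) = L → L.comap (MulEquiv.toMonoidHom α) = L := fun L hL ↦ by
    have h₁ : Function.IsPeriodicPt
        (fun M : Subgroup P ↦ M.comap (MulEquiv.toMonoidHom α)) 2 L := hL
    have h₂ : Function.IsPeriodicPt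
        (fun M : Subgroup P ↦ M.comap (MulEquiv.toMonoidHom α)) p L := by
      rw [Function.IsPeriodicPt, Function.IsFixedPt, comap_iterate, hαp]
      rfl
    have h := h₁.gcd h₂
    rw [(Nat.coprime_primes Nat.prime_two hp).mpr hp2.symm] at h
    exact h
  have hne : ∀ L : Subgroup P, L.index = 2 → L.comap (MulEquiv.toMonoidHom α) ≠ L := by
    intro L hL hLα
    have hall : ∀ M : Subgroup P, M.index = 2 → M.comap (MulEquiv.toMonoidHom α) = M := by
      intro M hM
      by_contra hMα
      rcases index_two_eq_or hxy hM (hidx M hM) (hidx _ (hidx M hM)) hL (Ne.symm hMα)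
        (fun h ↦ hMα (hper M h.symm)) (fun h ↦ hMα (hinj h).symm) with rfl | rfl | rfl
      · exact hMα hLα
      · exact hMα (hinj hLα)
      · exact hMα (hinj (hinj hLα))
    let S : Subgroup P := (MulEquiv.toMonoidHom α).eqLocus (MonoidHom.id P)
    have hS : S ≠ ⊤ := fun h ↦ hα <| MulEquiv.ext fun g ↦
      show g ∈ S from h ▸ Subgroup.mem_top g
    obtain ⟨M, hM, hSM⟩ := exists_index_two_le hP hS
    have hMα : ∀ g, MulAut.toPerm P α g ∉ M ↔ g ∉ M := fun g ↦ not_congr <| by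
      conv_rhs => rw [← hall M hM]
      rfl
    have := Fintype.ofFinite P
    obtain ⟨k, hk⟩ := IsPGroup.iff_card.mp (hP.to_subgroup M)
    have hcard : Fintype.card {g // g ∉ M} = 2 ^ k := by
      have h := M.card_mul_index
      rw [hM, Nat.card_eq_fintype_card, Nat.card_eq_fintype_card] at h
      rw [Nat.card_eq_fintype_card] at hk
      rw [Fintype.card_subtype_compl, ← h]
      omega
    have : Fact p.Prime := ⟨hp⟩
    obtain ⟨⟨g, hg⟩, hfix⟩ := Equiv.Perm.exists_fixed_point_of_prime (p := p) (n := 1)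
      (σ := (MulAut.toPerm P α).subtypePerm hMα)
      (by
        rw [hcard]
        exact fun h ↦ hp2 ((Nat.prime_dvd_prime_iff_eq hp Nat.prime_two).mp
          (hp.dvd_of_dvd_pow h)))
      (by
        rw [pow_one, Equiv.Perm.subtypePerm_pow]
        ext g
        simp [← map_pow, hαp])
    exact hg (hSM (show α g = g from congrArg Subtype.val hfix))
  exact ⟨hs, hne, fun L hL h ↦ hne L hL (hper L h)⟩

theorem nonempty_mulEquiv_homocyclic {x y : P} {n : ℕ}
    (h : ∀ g : P, ∃ i j : ℤ, g = x ^ i * y ^ j) (hcomm : ∀ a b : P, a * b = b * a)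
    (hn : ∀ g : P, g ^ n = 1) (hind : ∀ i j : ℤ, x ^ i * y ^ j = 1 → (n : ℤ) ∣ i ∧ (n : ℤ) ∣ j) :
    Nonempty (P ≃* Multiplicative (ZMod n × ZMod n)) := by
  have hz : ∀ z : P, zmultiplesHom (Additive P) (Additive.ofMul z) n = 0 := fun z ↦ by
    rw [zmultiplesHom_apply, ← ofMul_zpow, zpow_natCast, hn, ofMul_one]
  let u := ZMod.lift n ⟨_, hz x⟩
  let v := ZMod.lift n ⟨_, hz y⟩
  let f : Multiplicative (ZMod n × ZMod n) →* P := AddMonoidHom.toMultiplicativeLeft <|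
    AddMonoidHom.noncommCoprod u v fun a b ↦ hcomm (u a).toMul (v b).toMul
  have hf : ∀ i j : ℤ, f (Multiplicative.ofAdd ((i : ZMod n), (j : ZMod n))) = x ^ i * y ^ j := by
    intro i j
    change (u i).toMul * (v j).toMul = _
    simp [u, v]
  refine ⟨(MulEquiv.ofBijective f ⟨?_, fun g ↦ ?_⟩).symm⟩
  · rw [injective_iff_map_eq_one]
    intro a ha
    obtain ⟨⟨i, j⟩, rfl⟩ := Multiplicative.ofAdd.surjective a
    obtain ⟨i, rfl⟩ := ZMod.intCast_surjective i
    obtain ⟨j, rfl⟩ := ZMod.intCast_surjective j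
    obtain ⟨hi, hj⟩ := hind i j ((hf i j).symm.trans ha)
    rw [(ZMod.intCast_zmod_eq_zero_iff_dvd i n).mpr hi,
      (ZMod.intCast_zmod_eq_zero_iff_dvd j n).mpr hj]
    rfl
  · obtain ⟨i, j, rfl⟩ := h g
    exact ⟨_, hf i j⟩

theorem nonempty_mulEquiv_quaternionGroup {x y : P} (h : ∀ g : P, ∃ i j : ℤ, g = x ^ i * y ^ j)
    (hc1 : ⁅x, y⁆ ≠ 1) (hx : ⁅x, y⁆ = x ^ 2) (hy : ⁅x, y⁆ = y ^ 2) :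
    Nonempty (P ≃* QuaternionGroup 2) := by
  have hxy := closure_eq_top_of_bicyclic h
  have hc : ⁅x, y⁆ ∈ Subgroup.center P := mem_center_of_commute hxy
    (hx ▸ Commute.pow_self x 2) (hy ▸ Commute.pow_self y 2)
  have hc2 : ⁅x, y⁆ ^ 2 = 1 := commutator_sq_of_sq_central hc (hx ▸ hc)
  have hx4 : x ^ 4 = 1 := by rw [show 4 = 2 * 2 from rfl, pow_mul, ← hx, hc2]
  have hconj : ∀ k : ℤ, x ^ k * y = y * (x ^ k)⁻¹ := by
    have h₁ : y * x⁻¹ * y⁻¹ = x := by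
      rw [commutatorElement_def, sq, mul_assoc, mul_assoc, mul_right_inj, ← mul_assoc] at hx
      exact hx
    intro k
    nth_rw 1 [← h₁]
    rw [conj_zpow, inv_mul_cancel_right, inv_zpow]
  have hz : zmultiplesHom (Additive P) (Additive.ofMul x) (2 * 2 : ℕ) = 0 := by
    rw [zmultiplesHom_apply, ← ofMul_zpow, zpow_natCast, hx4, ofMul_one]
  let e : ZMod (2 * 2) → P := fun i ↦ (ZMod.lift (2 * 2) ⟨_, hz⟩ i).toMul
  have he : ∀ k : ℤ, e k = x ^ k := fun k ↦ by simp [e]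
  have hadd : ∀ i j, e (i + j) = e i * e j := fun i j ↦ by simp [e]
  have hsub : ∀ i j, e (i - j) = (e j)⁻¹ * e i := fun i j ↦ by
    rw [sub_eq_neg_add, hadd]
    simp [e]
  have hey : ∀ i, e i * y = y * (e i)⁻¹ := fun i ↦ by
    obtain ⟨k, rfl⟩ := ZMod.intCast_surjective i
    rw [he, hconj]
  have he2 : e 2 = y ^ 2 := by
    rw [← hy, hx]
    exact_mod_cast he 2
  have hyc : ∀ g : P, g * y ^ 2 = y ^ 2 * g := fun g ↦ by
    rw [← hy, Subgroup.mem_center_iff.mp hc g]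
  let f : QuaternionGroup 2 →* P := MonoidHom.mk'
    (fun | .a i => e i | .xa i => y * e i) (by
      rintro (i | i) (j | j)
      · simp [hadd]
      · simp only [QuaternionGroup.a_mul_xa, hsub]
        rw [← mul_assoc, ← mul_assoc, hey]
      · simp [hadd, mul_assoc]
      · simp only [QuaternionGroup.xa_mul_xa]
        rw [hsub, hadd, Nat.cast_ofNat, he2, mul_assoc y, ← mul_assoc (e i), hey,
          ← mul_assoc (e i)⁻¹, hyc (e i)⁻¹]
        simp only [sq, mul_assoc])
  have hfa : ∀ i, f (.a i) = e i := fun i ↦ rfl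
  have hfxa : ∀ i, f (.xa i) = y * e i := fun i ↦ rfl
  refine ⟨(MulEquiv.ofBijective f ⟨?_, fun g ↦ ?_⟩).symm⟩
  · rw [injective_iff_map_eq_one]
    intro q hq
    have hcases : ∀ q : QuaternionGroup 2, q = 1 ∨ q = .a 2 ∨ q ^ 2 = .a 2 := by decide
    have h2 : f (.a 2) ≠ 1 := by rwa [hfa, he2, ← hy]
    rcases hcases q with h | h | h
    · exact h
    · exact absurd (h ▸ hq) h2
    · exact absurd (by rw [← h, map_pow, hq, one_pow]) h2
  · have hx' : x ∈ f.range := ⟨.a 1, by rw [hfa]; simpa using he 1⟩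
    have hy' : y ∈ f.range := ⟨.xa 0, by rw [hfxa]; simpa using he 0⟩
    obtain ⟨i, j, rfl⟩ := h g
    exact mul_mem (zpow_mem hx' i) (zpow_mem hy' j)

end Bicyclic

/-- If `P` is a finite bicyclic `2`-group whose automorphism group is not a
`2`-group, then `P` is homocyclic or quaternion of order `8`. -/
theorem bicyclic_aut_not_two_group (P : Type*) [Group P] [Finite P]
    (hP2 : IsPGroup 2 P) (hbi : IsBicyclic P)
    (haut : ¬ IsPGroup 2 (MulAut P)) :
    (∃ n : ℕ, 1 ≤ n ∧ Nonempty (P ≃* Multiplicative (ZMod (2 ^ n) × ZMod (2 ^ n)))) ∨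
      Nonempty (P ≃* QuaternionGroup 2) := by
  obtain ⟨x, y, h⟩ := hbi
  have hxy := closure_eq_top_of_bicyclic h
  have : Finite (MulAut P) := Finite.of_injective _ DFunLike.coe_injective
  obtain ⟨p, hp, hp2, hdvd⟩ : ∃ p : ℕ, p.Prime ∧ p ≠ 2 ∧ p ∣ Nat.card (MulAut P) := by
    by_contra! H
    refine haut (IsPGroup.of_card (n := (Nat.card (MulAut P)).primeFactorsList.length)
      (Nat.eq_prime_pow_of_unique_prime_dvd Nat.card_pos.ne' fun {d} hd hdvd ↦ ?_))
    by_contra hd2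
    exact H d hd hd2 hdvd
  have : Fact p.Prime := ⟨hp⟩
  obtain ⟨α, hα⟩ := exists_prime_orderOf_dvd_card' p hdvd
  have hα1 : α ≠ 1 := fun h1 ↦ hp.one_lt.ne' (by rw [← hα, h1, orderOf_one])
  have hrot := rotatesIndexTwo_of_prime hP2 hxy hp hp2 (hα ▸ pow_orderOf_eq_one α) hα1
  by_cases hc1 : ⁅x, y⁆ = 1
  · left
    have hcomm := commute_of_generators hxy (commutatorElement_eq_one_iff_commute.mp hc1)
    obtain ⟨n, hn, hind⟩ := hrot.exists_pow_eq_one hP2 hxy hcomm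
    refine ⟨n, ?_, nonempty_mulEquiv_homocyclic h hcomm hn (by exact_mod_cast hind)⟩
    by_contra! hn0
    obtain rfl : n = 0 := by omega
    refine hα1 (MulEquiv.ext fun g ↦ ?_)
    have h1 : ∀ g : P, g = 1 := by simpa using hn
    rw [h1 (α g), h1 ((1 : MulAut P) g)]
  · right
    have hsq := commutator_eq_one_or_sq_eq _ P rfl hP2 _ hrot x y h
    obtain ⟨hx, hy⟩ := hsq.resolve_left hc1
    exact nonempty_mulEquiv_quaternionGroup h hc1 hx hy
end

section
/- Let P be a finite metacyclic 2-group of order 2^n with n ≥ 3 whose nilpotency class is strictly less than n − 1 (i.e., P does not have maximal class). Then for every k ≥ 1, every subgroup Q of P that is isomorphic to (ℤ/2^k ℤ) × (ℤ/2^k ℤ) equals Ω_k(P), the subgroup of P generated by all elements x ∈ P with x^(2^k) = 1. -/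
/-- A group is metacyclic if it has a cyclic normal subgroup with cyclic quotient. -/
def IsMetacyclic (P : Type*) [Group P] : Prop :=
  ∃ (N : Subgroup P) (_ : N.Normal), IsCyclic N ∧ IsCyclic (P ⧸ N)

/-- In a finite cyclic group, a subgroup of order `m` contains every solution of `x ^ m = 1`. -/
theorem IsCyclic.mem_of_pow_card_eq_one {C : Type*} [Group C] [Finite C] [IsCyclic C]
    (H : Subgroup C) {m : ℕ} (hH : Nat.card H = m) {x : C} (hx : x ^ m = 1) : x ∈ H := by
  classical
  have := Fintype.ofFinite C
  have hm : 0 < m := hH ▸ Nat.card_pos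
  have hsub : (Finset.univ.filter (· ∈ H)) ⊆ Finset.univ.filter (fun y : C => y ^ m = 1) := by
    intro y hy
    simp only [Finset.mem_filter, Finset.mem_univ, true_and] at hy ⊢
    have : (⟨y, hy⟩ : H) ^ Nat.card H = 1 := pow_card_eq_one'
    rw [hH] at this
    simpa using congrArg Subtype.val this
  have hcard : (Finset.univ.filter (· ∈ H)).card = m := by
    rw [← hH, Nat.card_eq_fintype_card, Fintype.card_subtype]
  have heq := Finset.eq_of_subset_of_card_le hsub
    ((IsCyclic.card_pow_eq_one_le hm).trans hcard.ge)
  have hmem : x ∈ Finset.univ.filter (fun y : C => y ^ m = 1) := by simpa using hx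
  rw [← heq] at hmem
  simpa using hmem

/-- In a finite cyclic group, the order of the group divides any exponent. -/
theorem IsCyclic.card_dvd_of_forall_pow_eq_one {C : Type*} [Group C] [IsCyclic C] {m : ℕ}
    (h : ∀ x : C, x ^ m = 1) : Nat.card C ∣ m := by
  rw [← IsCyclic.exponent_eq_card]
  exact Monoid.exponent_dvd_of_forall_pow_eq_one h

/-- An element of `2`-power order lies in any subgroup containing one of its odd powers. -/
theorem Subgroup.mem_of_odd_zpow_mem {G : Type*} [Group G] (H : Subgroup G) {x : G} {n : ℕ}
    (hx : x ^ 2 ^ n = 1) {o : ℤ} (ho : Odd o) (h : x ^ o ∈ H) : x ∈ H := by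
  have hco : IsCoprime o ((2 : ℤ) ^ n) := by
    obtain ⟨t, rfl⟩ := ho
    exact IsCoprime.pow_right ⟨1, -t, by ring⟩
  obtain ⟨s, t, hst⟩ := hco
  have hx' : x ^ ((2 : ℤ) ^ n) = 1 := by exact_mod_cast hx
  have : x = (x ^ o) ^ s := by
    conv_lhs => rw [← zpow_one x, ← hst, zpow_add, mul_comm s o, mul_comm t, zpow_mul, zpow_mul,
      hx', one_zpow, mul_one]
  rw [this]
  exact H.zpow_mem h s

/-- For `v ≡ 1 [ZMOD 4]`, the `2`-adic valuation of `1 + v + ⋯ + v ^ (2 ^ k - 1)` is `k`. -/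
theorem geom_sum_two_pow_eq_mul_odd {v : ℤ} (hv : v % 4 = 1) (k : ℕ) :
    ∃ o : ℤ, Odd o ∧ ∑ i ∈ Finset.range (2 ^ k), v ^ i = 2 ^ k * o := by
  induction k with
  | zero => exact ⟨1, odd_one, by simp⟩
  | succ k ih =>
    obtain ⟨o, ho, hs⟩ := ih
    have h4 : v ^ 2 ^ k % 4 = 1 := by
      have : v ^ 2 ^ k ≡ 1 ^ 2 ^ k [ZMOD 4] := Int.ModEq.pow _ hv
      simpa [Int.ModEq] using this
    obtain ⟨t, ht⟩ : ∃ t, v ^ 2 ^ k = 4 * t + 1 := ⟨v ^ 2 ^ k / 4, by omega⟩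
    refine ⟨o * (2 * t + 1), ho.mul ⟨t, rfl⟩, ?_⟩
    rw [pow_succ 2 k, mul_two, Finset.sum_range_add]
    simp only [pow_add]
    rw [← Finset.mul_sum, hs, ht]
    ring

theorem mul_pow_of_conj_eq_zpow {G : Type*} [Group G] {a c : G} {v : ℤ}
    (hc : c * a * c⁻¹ = a ^ v) (j : ℤ) (m : ℕ) :
    (a ^ j * c) ^ m = a ^ (j * ∑ i ∈ Finset.range m, v ^ i) * c ^ m := by
  induction m with
  | zero => simp
  | succ m ih =>
    have h1 (e : ℤ) : c * a ^ e = a ^ (v * e) * c := by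
      rw [zpow_mul, ← hc, conj_zpow]
      group
    rw [pow_succ', ih, geom_sum_succ, mul_assoc, ← mul_assoc c, h1, pow_succ' c, mul_assoc,
      ← mul_assoc, ← zpow_add]
    congr 2
    ring

/-- If conjugation by some element multiplies exponents of `a` by `v ≡ 3 [ZMOD 4]`, then
`a ^ 2 ^ i` lies in the `i`-th term of the lower central series. -/
theorem pow_two_pow_mem_lowerCentralSeries {G : Type*} [Group G] {a c : G} {n : ℕ}
    (ha : a ^ 2 ^ n = 1) {v : ℤ} (hv : v % 4 = 3) (hc : c * a * c⁻¹ = a ^ v) (i : ℕ) :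
    a ^ 2 ^ i ∈ (⊤ : Subgroup G).lowerCentralSeries i := by
  induction i with
  | zero => simp
  | succ i ih =>
    obtain ⟨o, ho, hvo⟩ : ∃ o : ℤ, Odd o ∧ v = 1 + 2 * o :=
      ⟨v / 2, by rw [Int.odd_iff]; omega, by omega⟩
    refine Subgroup.mem_of_odd_zpow_mem _ (n := n) (o := o) ?_ ho ?_
    · rw [← pow_mul, mul_comm, pow_mul, ha, one_pow]
    · have h := Subgroup.commutator_mem_commutator (Subgroup.mem_top c) ih
      rw [Subgroup.commutator_comm, ← Subgroup.lowerCentralSeries_succ, commutatorElement_def,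
        ← conj_pow, hc] at h
      convert h using 1
      rw [← zpow_natCast (a ^ v), ← zpow_natCast a, ← zpow_natCast a, ← zpow_mul, ← zpow_mul,
        ← zpow_neg, ← zpow_add, hvo]
      congr 1
      push_cast
      ring

/-- A subgroup of order `m * m` and exponent dividing `m` meets a cyclic normal subgroup with
cyclic quotient, and projects to that quotient, in subgroups of order `m`. -/
theorem card_subgroupOf_and_card_map_mk' {G : Type*} [Group G] [Finite G] (N : Subgroup G)
    [N.Normal] [IsCyclic N] [IsCyclic (G ⧸ N)] (Q : Subgroup G) {m : ℕ}
    (hcard : Nat.card Q = m * m) (hexp : ∀ q ∈ Q, q ^ m = 1) :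
    Nat.card (Q.subgroupOf N) = m ∧ Nat.card (Q.map (QuotientGroup.mk' N)) = m := by
  have hmm : 0 < m * m := hcard ▸ Nat.card_pos
  have hm : 0 < m := Nat.pos_of_mul_pos_left hmm
  have h1 : Nat.card (Q.subgroupOf N) ∣ m := by
    refine IsCyclic.card_dvd_of_forall_pow_eq_one fun x => ?_
    have := hexp _ (Subgroup.mem_subgroupOf.1 x.2)
    exact Subtype.ext (Subtype.ext (by simpa using this))
  have h2 : Nat.card (Q.map (QuotientGroup.mk' N)) ∣ m := by
    refine IsCyclic.card_dvd_of_forall_pow_eq_one ?_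
    rintro ⟨y, hy⟩
    obtain ⟨q, hq, rfl⟩ := Subgroup.mem_map.1 hy
    refine Subtype.ext ?_
    rw [SubmonoidClass.coe_pow, Subgroup.coe_one, ← map_pow, hexp q hq, map_one]
  have hprod : Nat.card (Q.subgroupOf N) * Nat.card (Q.map (QuotientGroup.mk' N)) = m * m := by
    have h3 : Nat.card (Q.subgroupOf N) = Nat.card (N.subgroupOf Q) := by
      rw [← Subgroup.card_map_of_injective N.subtype_injective,
        ← Subgroup.card_map_of_injective Q.subtype_injective,
        Subgroup.subgroupOf_map_subtype, Subgroup.subgroupOf_map_subtype, inf_comm]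
    have h4 := Subgroup.relIndex_ker (K := Q) (QuotientGroup.mk' N)
    rw [QuotientGroup.ker_mk'] at h4
    rw [h3, ← h4, ← hcard]
    exact Subgroup.card_mul_index (N.subgroupOf Q)
  have hl1 := Nat.le_of_dvd hm h1
  have hl2 := Nat.le_of_dvd hm h2
  constructor <;> nlinarith

/-- In a cyclic group of order divisible by `4`, every element with trivial square is a square. -/
theorem IsCyclic.exists_sq_eq_of_sq_eq_one {C : Type*} [Group C] [Finite C] [IsCyclic C]
    (h4 : 4 ∣ Nat.card C) {y : C} (hy : y ^ 2 = 1) : ∃ d : C, d ^ 2 = y := by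
  obtain ⟨g, hg⟩ := IsCyclic.exists_generator (α := C)
  obtain ⟨t, rfl⟩ := Subgroup.mem_zpowers_iff.1 (hg y)
  have h : (Nat.card C : ℤ) ∣ t * 2 := by
    rw [← orderOf_eq_card_of_forall_mem_zpowers hg, orderOf_dvd_iff_zpow_eq_one, zpow_mul]
    exact_mod_cast hy
  have h' : (4 : ℤ) ∣ t * 2 := dvd_trans (by exact_mod_cast h4) h
  refine ⟨g ^ (t / 2), ?_⟩
  rw [← zpow_natCast, ← zpow_mul]
  congr 1
  push_cast
  omega

/-- If `c` acts on `a` as an exponent `v` and commutes with the powers of `a` of order dividing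
`m`, then `v ≡ 1` modulo `m`. -/
theorem dvd_sub_one_of_conj_eq_zpow {G : Type*} [Group G] [Finite G] {a c : G} {m : ℕ}
    (hm : m ∣ orderOf a) (hcomm : ∀ z ∈ Subgroup.zpowers a, z ^ m = 1 → Commute c z) {v : ℤ}
    (hv : c * a * c⁻¹ = a ^ v) : (m : ℤ) ∣ v - 1 := by
  obtain ⟨l, hl⟩ := hm
  have hl0 : (l : ℤ) ≠ 0 := by
    rintro h
    have := orderOf_pos a
    simp_all
  have hz : a ^ l ∈ Subgroup.zpowers a := Subgroup.npow_mem_zpowers a l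
  have hz1 : (a ^ l) ^ m = 1 := by rw [← pow_mul, mul_comm, ← hl, pow_orderOf_eq_one]
  have h := (hcomm _ hz hz1).eq
  have h2 : (a ^ v) ^ l = a ^ l := by rw [← hv, conj_pow, h, mul_inv_cancel_right]
  have h3 : a ^ (v * l - l : ℤ) = 1 := by
    rw [zpow_sub, zpow_mul, zpow_natCast, zpow_natCast, h2, mul_inv_cancel]
  rw [← orderOf_dvd_iff_zpow_eq_one, hl] at h3
  refine Int.dvd_of_mul_dvd_mul_right hl0 ?_
  convert h3 using 1
  · push_cast; rfl
  · ring

/-- In a metacyclic `2`-group of order `2^n` (`n ≥ 3`) which does not have maximal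
class, every homocyclic subgroup isomorphic to `C_{2^k} × C_{2^k}` equals
`Ω_k(P)`, the subgroup generated by all elements `x` with `x^(2^k) = 1`. -/
theorem homocyclic_subgroup_eq_omega (P : Type*) [Group P] [Finite P]
    [Group.IsNilpotent P]
    (n : ℕ) (hn : 3 ≤ n) (hcard : Nat.card P = 2 ^ n) (hmc : IsMetacyclic P)
    (hclass : Group.nilpotencyClass P < n - 1)
    (k : ℕ) (hk : 1 ≤ k) (Q : Subgroup P)
    (hQ : Nonempty (Q ≃* Multiplicative (ZMod (2 ^ k) × ZMod (2 ^ k)))) :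
    Q = Subgroup.closure {x : P | x ^ (2 ^ k) = 1} := by
  obtain ⟨N, _, _, _⟩ := hmc
  obtain ⟨e⟩ := hQ
  have hQcard : Nat.card Q = 2 ^ k * 2 ^ k := by
    rw [Nat.card_congr e.toEquiv, Nat.card_congr Multiplicative.toAdd, Nat.card_prod, Nat.card_zmod]
  have hQexp : ∀ q ∈ Q, q ^ 2 ^ k = 1 := by
    intro q hq
    have : (⟨q, hq⟩ : Q) ^ 2 ^ k = 1 := by
      apply e.injective
      rw [map_pow, map_one]
      apply Multiplicative.toAdd.injective
      have hz (y : ZMod (2 ^ k)) : 2 ^ k • y = 0 := by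
        rw [nsmul_eq_mul, ZMod.natCast_self, zero_mul]
      exact Prod.ext (hz _) (hz _)
    simpa using congrArg Subtype.val this
  have hQcomm : ∀ c ∈ Q, ∀ z ∈ Q, Commute c z := by
    intro c hc z hz
    have : (⟨c, hc⟩ : Q) * ⟨z, hz⟩ = ⟨z, hz⟩ * ⟨c, hc⟩ :=
      e.injective (by rw [map_mul, map_mul, mul_comm])
    exact congrArg Subtype.val this
  obtain ⟨hN, hM⟩ := card_subgroupOf_and_card_map_mk' N Q hQcard hQexp
  have hNQ : ∀ z ∈ N, z ^ 2 ^ k = 1 → z ∈ Q := fun z hz hz1 =>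
    Subgroup.mem_subgroupOf.1 (IsCyclic.mem_of_pow_card_eq_one _ hN (x := (⟨z, hz⟩ : N))
      (Subtype.ext (by simpa using hz1)))
  obtain ⟨a, rfl⟩ := (Subgroup.isCyclic_iff_exists_zpowers_eq_top N).1 ‹_›
  set N := Subgroup.zpowers a
  have hconj : ∀ c : P, ∃ v : ℤ, c * a * c⁻¹ = a ^ v := fun c => by
    obtain ⟨v, hv⟩ := Subgroup.mem_zpowers_iff.1
      (Subgroup.Normal.conj_mem ‹N.Normal› a (Subgroup.mem_zpowers a) c)
    exact ⟨v, hv.symm⟩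
  have haexp : a ^ 2 ^ n = 1 := hcard ▸ pow_card_eq_one'
  have hdvd : 2 ^ k ∣ orderOf a := by
    rw [← Nat.card_zpowers, ← hN]
    exact Subgroup.card_subgroup_dvd_card _
  have hmod : ∀ c ∈ Q, ∀ v : ℤ, c * a * c⁻¹ = a ^ v → (2 : ℤ) ^ k ∣ v - 1 := fun c hc v hv => by
    exact_mod_cast dvd_sub_one_of_conj_eq_zpow hdvd
      (fun z hz hz1 => hQcomm c hc z (hNQ z hz hz1)) hv
  have hone : ∀ c ∈ Q, ∃ v : ℤ, c * a * c⁻¹ = a ^ v ∧ v % 4 = 1 := by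
    intro c hc
    obtain ⟨v, hv⟩ := hconj c
    have hdv := hmod c hc v hv
    by_cases hv4 : v % 4 = 1
    · exact ⟨v, hv, hv4⟩
    have hk1 : k = 1 := by
      by_contra hne
      have : (2 : ℤ) ^ 2 ∣ v - 1 := (pow_dvd_pow 2 (by omega)).trans hdv
      omega
    subst hk1
    rw [pow_one] at hdv
    have hcN : Nat.card N * Nat.card (P ⧸ N) = 2 ^ n := by
      rw [← hcard]; exact N.card_mul_index
    obtain ⟨s, -, hs⟩ := (Nat.dvd_prime_pow Nat.prime_two).1 (Dvd.intro_left _ hcN)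
    obtain hs2 | hs2 : s < 2 ∨ 2 ≤ s := lt_or_ge _ _
    · exfalso
      have hmem := pow_two_pow_mem_lowerCentralSeries haexp (v := v) (by omega) hv (n - 2)
      rw [Subgroup.lowerCentralSeries_eq_bot_iff_nilpotencyClass_le.2 (by omega),
        Subgroup.mem_bot, ← orderOf_dvd_iff_pow_eq_one, ← Nat.card_zpowers] at hmem
      have h1 := Nat.le_of_dvd (by positivity) hmem
      have h2 : Nat.card (P ⧸ N) ≤ 2 := by
        rw [hs]; interval_cases s <;> norm_num
      obtain ⟨t, rfl⟩ : ∃ t, n = t + 2 := ⟨n - 2, by omega⟩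
      have h3 := Nat.mul_le_mul h1 h2
      rw [hcN, Nat.add_sub_cancel, pow_add] at h3
      have := Nat.two_pow_pos t
      omega
    · have hc2 : (c : P ⧸ N) ^ 2 = 1 := by
        have := hQexp c hc
        rw [pow_one] at this
        rw [← QuotientGroup.mk_pow, this, QuotientGroup.mk_one]
      obtain ⟨d, hd⟩ := IsCyclic.exists_sq_eq_of_sq_eq_one
        (hs ▸ (pow_dvd_pow 2 hs2 : 2 ^ 2 ∣ 2 ^ s)) hc2
      obtain ⟨d, rfl⟩ := QuotientGroup.mk_surjective d
      rw [← QuotientGroup.mk_pow, QuotientGroup.eq] at hd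
      obtain ⟨j, hj⟩ := Subgroup.mem_zpowers_iff.1 hd
      have hcd : c = d ^ 2 * a ^ j := by rw [hj]; group
      obtain ⟨w, hw⟩ := hconj d
      have hcw : c * a * c⁻¹ = a ^ (w * w) := by
        calc c * a * c⁻¹ = d * (d * a * d⁻¹) * d⁻¹ := by rw [hcd, sq]; group
          _ = a ^ (w * w) := by rw [hw, ← conj_zpow, hw, zpow_mul]
      refine ⟨w * w, hcw, ?_⟩
      have hdw := hmod c hc _ hcw
      rw [pow_one] at hdw
      obtain ⟨u, hu | hu⟩ := Int.even_or_odd' w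
      · rw [hu, mul_assoc] at hdw
        omega
      · have : w * w = 4 * (u * u + u) + 1 := by rw [hu]; ring
        omega
  refine le_antisymm (fun q hq => Subgroup.subset_closure (k := {x : P | x ^ 2 ^ k = 1}) (hQexp q hq))
    ((Subgroup.closure_le Q).2 fun x hx => ?_)
  have hxM : (x : P ⧸ N) ∈ Q.map (QuotientGroup.mk' N) := by
    refine IsCyclic.mem_of_pow_card_eq_one _ hM ?_
    rw [← QuotientGroup.mk_pow, Set.mem_ofPred.1 hx, QuotientGroup.mk_one]
  obtain ⟨c, hc, hcx⟩ := hxM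
  have hxc : x * c⁻¹ ∈ N := by
    have h := QuotientGroup.eq.1 hcx
    have := Subgroup.Normal.conj_mem ‹N.Normal› _ h c
    simpa [mul_assoc] using this
  obtain ⟨j, hj⟩ := Subgroup.mem_zpowers_iff.1 hxc
  obtain rfl : x = a ^ j * c := by rw [hj, inv_mul_cancel_right]
  obtain ⟨v, hv, hv4⟩ := hone c hc
  obtain ⟨o, ho, hsum⟩ := geom_sum_two_pow_eq_mul_odd hv4 k
  have hpow : (a ^ j * c) ^ 2 ^ k = 1 := hx
  rw [mul_pow_of_conj_eq_zpow hv, hQexp c hc, mul_one, hsum, ← mul_assoc, zpow_mul, zpow_mul] at hpow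
  refine Q.mul_mem (hNQ _ (Subgroup.zpow_mem_zpowers a j) ?_) hc
  rw [← Subgroup.mem_bot]
  refine Subgroup.mem_of_odd_zpow_mem ⊥ (n := n) (hcard ▸ pow_card_eq_one') ho ?_
  rw [Subgroup.mem_bot]
  exact_mod_cast hpow
end
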